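/- arXiv:1306.4766 — 6 statements merged into one kernel-verified Lean document; each statement's English description precedes it below -/
import Mathlib

section
/- For q ∈ ℍ[ℚ₂, 2, 5], one has ‖N(q)‖ ≤ 1 if and only if there exist a, b, c, d ∈ ℤ₂ with q = a + b·ω + c·i + d·(i·ω). In other words, the maximal order O_D of the quaternion division algebra over ℚ₂ is the free ℤ₂-module with basis {1, ω, i, i·ω}, where ω = (1 + j)/2. -/
open Quaternion

noncomputable section

/-- `D` is the quaternion algebra `ℍ[ℚ₂, 2, 5]` with `i² = 2`, `j² = 5`, `i·j = -j·i`;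
this is the unique quaternion division algebra over `ℚ₂`. -/
abbrev D : Type := ℍ[ℚ_[2], 2, 5]

/-- The basis quaternion `i`. -/
def qi : D := ⟨0, 1, 0, 0⟩

/-- The basis quaternion `j`. -/
def qj : D := ⟨0, 0, 1, 0⟩

/-- `ω = (1 + j)/2`. -/
def qω : D := ⟨1/2, 0, 1/2, 0⟩

/-- The reduced norm `N(q) = q · (star q)` (as a scalar). -/
def qN (q : D) : ℚ_[2] := (q * star q).re

/-- The reduced trace `T(q) = q + star q = 2·q.re` (as a scalar). -/
def qT (q : D) : ℚ_[2] := 2 * q.re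

theorem aux_unit (u : ℚ_[2]) (hu : ‖u‖ ≤ 1) : ‖u ^ 2 + u - 1‖ = 1 := by
  have h : ‖u ^ 2 + u‖ < 1 := by
    obtain ⟨v, rfl⟩ : ∃ v : ℤ_[2], (v : ℚ_[2]) = u := ⟨⟨u, hu⟩, rfl⟩
    have key : PadicInt.toZMod (v ^ 2 + v) = 0 := by
      rw [map_add, map_pow]
      generalize PadicInt.toZMod v = z
      revert z
      decide
    have h2 : v ^ 2 + v ∈ RingHom.ker (PadicInt.toZMod (p := 2)) := key
    rw [PadicInt.ker_toZMod, IsLocalRing.mem_maximalIdeal, PadicInt.mem_nonunits] at h2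
    simpa [PadicInt.norm_def] using h2
  have h1 : ‖(-1 : ℚ_[2])‖ = 1 := by simp
  rw [sub_eq_add_neg, Padic.add_eq_max_of_ne (by rw [h1]; exact h.ne), h1]
  exact max_eq_right h.le

theorem aux_f (a b : ℚ_[2]) : ∃ m : ℚ_[2], ‖a‖ ≤ ‖m‖ ∧ ‖b‖ ≤ ‖m‖ ∧
    ‖a ^ 2 + a * b - b ^ 2‖ = ‖m‖ ^ 2 ∧ (m = a ∨ m = b) := by
  rcases le_total ‖a‖ ‖b‖ with h | h
  · refine ⟨b, h, le_rfl, ?_, Or.inr rfl⟩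
    by_cases hb : b = 0
    · subst hb
      have : a = 0 := by simpa using h
      simp [this]
    · have hu : ‖a / b‖ ≤ 1 := by
        rw [norm_div]; exact div_le_one_of_le₀ h (norm_nonneg _)
      have e : a ^ 2 + a * b - b ^ 2 = b ^ 2 * ((a / b) ^ 2 + a / b - 1) := by
        field_simp
      rw [e, norm_mul, aux_unit _ hu, norm_pow, mul_one]
  · refine ⟨a, le_rfl, h, ?_, Or.inl rfl⟩
    by_cases ha : a = 0
    · subst ha
      have : b = 0 := by simpa using h
      simp [this]
    · have hu : ‖-(b / a)‖ ≤ 1 := by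
        rw [norm_neg, norm_div]; exact div_le_one_of_le₀ h (norm_nonneg _)
      have e : a ^ 2 + a * b - b ^ 2 = -(a ^ 2 * ((-(b / a)) ^ 2 + -(b / a) - 1)) := by
        field_simp
        ring
      rw [e, norm_neg, norm_mul, aux_unit _ hu, norm_pow, mul_one]

theorem aux_two : ‖(2 : ℚ_[2])‖ = 2⁻¹ := by
  simpa using Padic.norm_p (p := 2)

theorem aux_par (m n : ℚ_[2]) (h : ‖m‖ ^ 2 = 2⁻¹ * ‖n‖ ^ 2) : m = 0 ∧ n = 0 := by
  by_cases hm : m = 0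
  · subst hm
    simpa using h
  by_cases hn : n = 0
  · subst hn
    simpa using h
  exfalso
  rw [Padic.norm_eq_zpow_neg_valuation hm, Padic.norm_eq_zpow_neg_valuation hn] at h
  have h3 : (2 : ℝ) ^ (-m.valuation * 2) = 2 ^ (-1 + -n.valuation * 2) := by
    rw [zpow_add₀ (by norm_num), zpow_mul, zpow_mul]
    simpa using h
  have := zpow_right_injective₀ (by norm_num : (0 : ℝ) < 2) (by norm_num) h3
  omega

theorem aux_main (a b c d : ℚ_[2]) :
    ‖(a ^ 2 + a * b - b ^ 2) - 2 * (c ^ 2 + c * d - d ^ 2)‖ ≤ 1 ↔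
      ‖a‖ ≤ 1 ∧ ‖b‖ ≤ 1 ∧ ‖c‖ ≤ 1 ∧ ‖d‖ ≤ 1 := by
  obtain ⟨m, ham, hbm, hm, hm'⟩ := aux_f a b
  obtain ⟨n, hcn, hdn, hn, hn'⟩ := aux_f c d
  have hN : ‖(a ^ 2 + a * b - b ^ 2) - 2 * (c ^ 2 + c * d - d ^ 2)‖
      = max (‖m‖ ^ 2) (2⁻¹ * ‖n‖ ^ 2) := by
    by_cases he : ‖m‖ ^ 2 = 2⁻¹ * ‖n‖ ^ 2
    · obtain ⟨rfl, rfl⟩ := aux_par m n he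
      have h1 : a ^ 2 + a * b - b ^ 2 = 0 := by simpa using hm
      have h2 : c ^ 2 + c * d - d ^ 2 = 0 := by simpa using hn
      simp [h1, h2]
    · have e : ‖-(2 * (c ^ 2 + c * d - d ^ 2))‖ = 2⁻¹ * ‖n‖ ^ 2 := by
        rw [norm_neg, norm_mul, hn, aux_two]
      rw [sub_eq_add_neg, Padic.add_eq_max_of_ne (by rw [hm, e]; exact he), hm, e]
  rw [hN, max_le_iff]
  constructor
  · rintro ⟨h1, h2⟩
    have hm1 : ‖m‖ ≤ 1 := by nlinarith [norm_nonneg m]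
    have hn2 : ‖n‖ < 2 := by nlinarith [norm_nonneg n]
    have hn1 : ‖n‖ ≤ 1 := by
      have := (Padic.norm_le_pow_iff_norm_lt_pow_add_one n 0).2 (by simpa using hn2)
      simpa using this
    exact ⟨ham.trans hm1, hbm.trans hm1, hcn.trans hn1, hdn.trans hn1⟩
  · rintro ⟨h1, h2, h3, h4⟩
    have hm1 : ‖m‖ ≤ 1 := by rcases hm' with rfl | rfl <;> assumption
    have hn1 : ‖n‖ ≤ 1 := by rcases hn' with rfl | rfl <;> assumption
    constructor <;> nlinarith [norm_nonneg m, norm_nonneg n]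

theorem aux_form (q : D) (a b c d : ℚ_[2]) :
    q = algebraMap ℚ_[2] D a + algebraMap ℚ_[2] D b * qω +
            algebraMap ℚ_[2] D c * qi + algebraMap ℚ_[2] D d * (qi * qω) ↔
    q.re = a + b / 2 ∧ q.imI = c + d / 2 ∧ q.imJ = b / 2 ∧ q.imK = d / 2 := by
  rw [QuaternionAlgebra.ext_iff]
  simp [qω, qi, QuaternionAlgebra.algebraMap_eq, div_eq_mul_inv]

theorem aux_N (q : D) :
    qN q = q.re ^ 2 - 2 * q.imI ^ 2 - 5 * q.imJ ^ 2 + 10 * q.imK ^ 2 := by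
  simp [qN]
  ring

/-- `‖N(q)‖ ≤ 1` iff `q = a + b·ω + c·i + d·(i·ω)` with `a, b, c, d ∈ ℤ₂`:
the maximal order `O_D` is the free `ℤ₂`-module with basis `{1, ω, i, i·ω}`. -/
theorem stmt_1 (q : D) :
    ‖qN q‖ ≤ 1 ↔
      ∃ a b c d : ℚ_[2], ‖a‖ ≤ 1 ∧ ‖b‖ ≤ 1 ∧ ‖c‖ ≤ 1 ∧ ‖d‖ ≤ 1 ∧
        q = algebraMap ℚ_[2] D a + algebraMap ℚ_[2] D b * qω +
            algebraMap ℚ_[2] D c * qi + algebraMap ℚ_[2] D d * (qi * qω) := by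
  constructor
  · intro h
    have e : qN q = ((q.re - q.imJ) ^ 2 + (q.re - q.imJ) * (2 * q.imJ) - (2 * q.imJ) ^ 2)
        - 2 * ((q.imI - q.imK) ^ 2 + (q.imI - q.imK) * (2 * q.imK) - (2 * q.imK) ^ 2) := by
      rw [aux_N]; ring
    rw [e, aux_main] at h
    obtain ⟨h1, h2, h3, h4⟩ := h
    refine ⟨_, _, _, _, h1, h2, h3, h4, ?_⟩
    rw [aux_form]
    refine ⟨?_, ?_, ?_, ?_⟩ <;> ring
  · rintro ⟨a, b, c, d, h1, h2, h3, h4, h⟩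
    rw [aux_form] at h
    obtain ⟨e1, e2, e3, e4⟩ := h
    have e : qN q = (a ^ 2 + a * b - b ^ 2) - 2 * (c ^ 2 + c * d - d ^ 2) := by
      rw [aux_N, e1, e2, e3, e4]; ring
    rw [e, aux_main]
    exact ⟨h1, h2, h3, h4⟩
end
end

section
/- Let r ∈ O_D be nonzero and let a₁, a₂ ∈ O_D be nonzero pure quaternions. Set z = a₁ − r·a₁·(star r). Then there exists a nonzero λ ∈ O_D with a₁ = r·a₁·(star r) + λ·a₂·(star λ) if and only if both: (1) there exists c ∈ ℚ₂, c ≠ 0, with N(z)·N(a₂) = c² (i.e., N(z)·N(a₂) is a nonzero square in ℚ₂), and (2) ‖N(z)‖ ≤ ‖N(a₂)‖ (i.e., N(z)·N(a₂)⁻¹ ∈ ℤ₂). -/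
open Quaternion

noncomputable section

theorem qN_eq (q : D) : qN q = q.re^2 - 2*q.imI^2 - 5*q.imJ^2 + 10*q.imK^2 := by
  simp [qN, QuaternionAlgebra.re_mul]; ring

theorem qN_mul (p q : D) : qN (p*q) = qN p * qN q := by
  simp only [qN_eq]
  simp
  ring

theorem mul_star_q (q : D) : q * star q = (qN q) • (1:D) := by
  rw [qN_eq]
  ext <;> simp <;> ring

theorem qN_star (q : D) : qN (star q) = qN q := by
  simp only [qN_eq]
  simp

theorem qN_smul (c : ℚ_[2]) (q : D) : qN (c • q) = c^2 * qN q := by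
  simp only [qN_eq]
  simp
  ring

theorem two_adic_sq {u : ℤ_[2]} (h : ‖u - 1‖ ≤ 1/8) : ∃ v : ℤ_[2], v^2 = u := by
  have := @hensels_lemma 2 _ ℤ_[2] _ _ (Polynomial.X^2 - Polynomial.C u) 1 ?_
  · obtain ⟨z, hz, -⟩ := this
    refine ⟨z, ?_⟩
    simp at hz
    linear_combination hz
  · have h2 : ‖(2:ℤ_[2])‖ = 1/2 := by
      have := PadicInt.norm_p (p := 2); norm_num at this ⊢; exact this
    have : ‖1 - u‖ < (1/2)^2 := by rw [norm_sub_rev]; norm_num at h ⊢; linarith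
    simpa [one_add_one_eq_two, h2] using this

theorem norm2 : ‖(2:ℚ_[2])‖ = 1/2 := by
  have := Padic.norm_p (p := 2); norm_num at this ⊢; exact this

theorem unit_mod8 (u : ℤ_[2]) (hu : ‖u‖ = 1) :
    ‖u - 1‖ ≤ 1/8 ∨ ‖u - 3‖ ≤ 1/8 ∨ ‖u - (-1)‖ ≤ 1/8 ∨ ‖u - (-3)‖ ≤ 1/8 := by
  have key : ∀ w : ℤ_[2], PadicInt.toZModPow 3 w = 0 → ‖w‖ ≤ 1/8 := by
    intro w hw
    have h1 : w ∈ RingHom.ker (PadicInt.toZModPow (p := 2) 3) := hw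
    rw [PadicInt.ker_toZModPow, ← PadicInt.norm_le_pow_iff_mem_span_pow] at h1
    norm_num at h1 ⊢; exact h1
  have hunit : IsUnit (PadicInt.toZModPow 3 u) := (PadicInt.isUnit_iff.2 hu).map _
  have h4 : ∀ v : ZMod (2^3), IsUnit v → v - 1 = 0 ∨ v - 3 = 0 ∨ v - (-1) = 0 ∨ v - (-3) = 0 := by
    intro v hv
    obtain ⟨w, hw⟩ := hv.exists_right_inv
    revert v w
    decide
  have h5 : ∀ n : ℤ, PadicInt.toZModPow (p := 2) 3 (u - n) = PadicInt.toZModPow 3 u - n := by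
    intro n; simp
  rcases h4 _ hunit with h | h | h | h
  · left; apply key; have := h5 1; push_cast at this; rw [this, h]
  · right; left; apply key; have := h5 3; push_cast at this; rw [this, h]
  · right; right; left; apply key; have := h5 (-1); push_cast at this; rw [this, h]
  · right; right; right; apply key; have := h5 (-3); push_cast at this; rw [this, h]

theorem unit_sq (u r r' : ℤ_[2]) (hr : ‖u - r‖ ≤ 1/8)
    (h1 : r * r' = 1) : ∃ v : ℤ_[2], u = r * v^2 := by
  obtain ⟨v, hv⟩ := two_adic_sq (u := u * r') (by
    have : u * r' - 1 = (u - r) * r' := by linear_combination h1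
    rw [this, norm_mul]
    have := PadicInt.norm_le_one r'
    nlinarith [norm_nonneg (u - r), norm_nonneg r'])
  exact ⟨v, by rw [hv]; linear_combination -u * h1⟩

theorem unit_class (u : ℤ_[2]) (hu : ‖u‖ = 1) :
    ∃ r : ℤ_[2], (r = 1 ∨ r = 3 ∨ r = -1 ∨ r = -3) ∧ ∃ v, u = r * v^2 := by
  have h3 : IsUnit (3 : ℤ_[2]) := by
    rw [PadicInt.isUnit_iff]
    have := (PadicInt.norm_intCast_lt_one_iff (p := 2) (z := 3)).not.2 (by norm_num)
    push_cast at this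
    exact le_antisymm (PadicInt.norm_le_one _) (not_lt.1 this)
  obtain ⟨t, ht⟩ := h3.exists_right_inv
  have h2 : ‖(2:ℤ_[2])‖ = 1/2 := by
      have := PadicInt.norm_p (p := 2); norm_num at this ⊢; exact this
  have h8 : ‖(8:ℤ_[2])‖ ≤ 1/8 := by
    rw [show (8:ℤ_[2]) = 2^3 by norm_num, norm_pow, h2]; norm_num
  rcases unit_mod8 u hu with h | h | h | h
  · exact ⟨1, by simp, unit_sq u 1 1 h (by norm_num)⟩
  · exact ⟨3, by simp, unit_sq u 3 t h ht⟩
  · exact ⟨-1, by simp, unit_sq u (-1) (-1) h (by norm_num)⟩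
  · exact ⟨-3, by simp, unit_sq u (-3) (-t) h (by linear_combination ht)⟩

theorem unit_class' (u : ℚ_[2]) (hu : ‖u‖ = 1) :
    ∃ r : ℚ_[2], (r = 1 ∨ r = 3 ∨ r = -1 ∨ r = -3) ∧ ∃ v, u = r * v^2 := by
  obtain ⟨r, hr, v, hv⟩ := unit_class ⟨u, hu.le⟩ hu
  have := congrArg (fun x : ℤ_[2] => (x : ℚ_[2])) hv
  refine ⟨r, ?_, v, by simpa using this⟩
  rcases hr with rfl | rfl | rfl | rfl
  · simp
  · right; left; norm_cast
  · simp
  · right; right; right; push_cast; norm_cast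

theorem sq_class (x : ℚ_[2]) (hx : x ≠ 0) :
    ∃ r : ℚ_[2], (r = 1 ∨ r = 3 ∨ r = -1 ∨ r = -3 ∨ r = 2 ∨ r = 6 ∨ r = -2 ∨ r = -6) ∧
      ∃ v, v ≠ 0 ∧ x = r * v^2 := by
  have h20 : (2:ℚ_[2]) ≠ 0 := by norm_num
  have h1 : ‖x * (2:ℚ_[2])^(-x.valuation)‖ = 1 := by
    rw [norm_mul, norm_zpow, norm2, Padic.norm_eq_zpow_neg_valuation hx]
    rw [one_div, inv_zpow, ← zpow_neg]
    push_cast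
    rw [← zpow_add₀ (by norm_num)]; simp
  obtain ⟨r, hr, v, hv⟩ := unit_class' _ h1
  have hx' : x = r * v^2 * 2^(x.valuation) := by
    rw [← hv, mul_assoc, ← zpow_add₀ h20]; simp
  have hv0 : v ≠ 0 := by
    rintro rfl; apply hx; rw [hx']; simp
  rcases Int.even_or_odd' x.valuation with ⟨k, hk | hk⟩
  · refine ⟨r, by tauto, v * 2^k, by positivity, ?_⟩
    conv_lhs => rw [hx', hk, two_mul, zpow_add₀ h20]
    ring
  · refine ⟨2 * r, ?_, v * 2^k, by positivity, ?_⟩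
    · rcases hr with rfl | rfl | rfl | rfl <;> norm_num
    conv_lhs => rw [hx', hk, zpow_add₀ h20, two_mul, zpow_add₀ h20]
    simp; ring


theorem exists_w : ∃ w : ℚ_[2], w^2 = -7 := by
  obtain ⟨v, hv⟩ := two_adic_sq (u := -7) (by
    have h2 : ‖(2:ℤ_[2])‖ = 1/2 := by
      have := PadicInt.norm_p (p := 2); norm_num at this ⊢; exact this
    rw [show (-7 - 1 : ℤ_[2]) = - 2^3 by norm_num, norm_neg, norm_pow, h2]; norm_num)
  refine ⟨v, ?_⟩
  have := congrArg (fun x : ℤ_[2] => (x : ℚ_[2])) hv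
  push_cast at this
  rw [this]; norm_cast

def IsNm (a t : ℚ_[2]) : Prop := ∃ x y, t = x^2 - a*y^2

theorem IsNm.mul {a s t : ℚ_[2]} (hs : IsNm a s) (ht : IsNm a t) : IsNm a (s*t) := by
  obtain ⟨x, y, rfl⟩ := hs
  obtain ⟨u, v, rfl⟩ := ht
  exact ⟨x*u + a*y*v, x*v+y*u, by ring⟩

theorem IsNm.sq (a k : ℚ_[2]) : IsNm a (k^2) := ⟨k, 0, by ring⟩

theorem IsNm.base {a t : ℚ_[2]} (h : IsNm a t) {k : ℚ_[2]} (hk : k ≠ 0) : IsNm (a*k^2) t := by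
  obtain ⟨x, y, rfl⟩ := h
  exact ⟨x, y/k, by field_simp⟩

theorem rep_index (a : ℚ_[2]) (ha : a = 3 ∨ a = -1 ∨ a = -3 ∨ a = 2 ∨ a = 6 ∨ a = -2 ∨ a = -6) :
    ∃ g : ℚ_[2], g ≠ 0 ∧ ∀ t : ℚ_[2],
      (t = 1 ∨ t = 3 ∨ t = -1 ∨ t = -3 ∨ t = 2 ∨ t = 6 ∨ t = -2 ∨ t = -6) →
      IsNm a t ∨ IsNm a (g * t) := by
  obtain ⟨w, hw⟩ := exists_w
  rcases ha with rfl | rfl | rfl | rfl | rfl | rfl | rfl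
  · refine ⟨-1, by norm_num, ?_⟩
    rintro t (rfl | rfl | rfl | rfl | rfl | rfl | rfl | rfl)
    · exact .inl ⟨1, 0, by norm_num⟩
    · exact .inr ⟨0, 1, by norm_num⟩
    · exact .inr ⟨1, 0, by norm_num⟩
    · exact .inl ⟨0, 1, by norm_num⟩
    · exact .inr ⟨1, 1, by norm_num⟩
    · exact .inl ⟨3, 1, by norm_num⟩
    · exact .inl ⟨1, 1, by norm_num⟩
    · exact .inr ⟨3, 1, by norm_num⟩
  · refine ⟨-1, by norm_num, ?_⟩
    rintro t (rfl | rfl | rfl | rfl | rfl | rfl | rfl | rfl)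
    · exact .inl ⟨1, 0, by norm_num⟩
    · exact .inr ⟨w, 2, by linear_combination (-1) * hw⟩
    · exact .inr ⟨1, 0, by norm_num⟩
    · exact .inl ⟨w, 2, by linear_combination (-1) * hw⟩
    · exact .inl ⟨1, 1, by norm_num⟩
    · exact .inr ⟨w-2, w+2, by linear_combination (-2) * hw⟩
    · exact .inr ⟨1, 1, by norm_num⟩
    · exact .inl ⟨w-2, w+2, by linear_combination (-2) * hw⟩
  · refine ⟨2, by norm_num, ?_⟩
    rintro t (rfl | rfl | rfl | rfl | rfl | rfl | rfl | rfl)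
    · exact .inl ⟨1, 0, by norm_num⟩
    · exact .inl ⟨0, 1, by norm_num⟩
    · exact .inl ⟨2*w, 3, by linear_combination (-4) * hw⟩
    · exact .inl ⟨9, 2*w, by linear_combination (-12) * hw⟩
    · exact .inr ⟨2, 0, by norm_num⟩
    · exact .inr ⟨0, 2*1, by norm_num⟩
    · exact .inr ⟨4*w, 6, by linear_combination (-16) * hw⟩
    · exact .inr ⟨18, 4*w, by linear_combination (-48) * hw⟩
  · refine ⟨3, by norm_num, ?_⟩
    rintro t (rfl | rfl | rfl | rfl | rfl | rfl | rfl | rfl)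
    · exact .inl ⟨1, 0, by norm_num⟩
    · exact .inr ⟨3, 0, by norm_num⟩
    · exact .inl ⟨1, 1, by norm_num⟩
    · exact .inr ⟨3, 3, by norm_num⟩
    · exact .inl ⟨2, 1, by norm_num⟩
    · exact .inr ⟨6, 3, by norm_num⟩
    · exact .inl ⟨0, 1, by norm_num⟩
    · exact .inr ⟨0, 3, by norm_num⟩
  · refine ⟨-1, by norm_num, ?_⟩
    rintro t (rfl | rfl | rfl | rfl | rfl | rfl | rfl | rfl)
    · exact .inl ⟨1, 0, by norm_num⟩
    · exact .inl ⟨3, 1, by norm_num⟩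
    · exact .inr ⟨1, 0, by norm_num⟩
    · exact .inr ⟨3, 1, by norm_num⟩
    · exact .inr ⟨2, 1, by norm_num⟩
    · exact .inr ⟨0, 1, by norm_num⟩
    · exact .inl ⟨2, 1, by norm_num⟩
    · exact .inl ⟨0, 1, by norm_num⟩
  · refine ⟨-1, by norm_num, ?_⟩
    rintro t (rfl | rfl | rfl | rfl | rfl | rfl | rfl | rfl)
    · exact .inl ⟨1, 0, by norm_num⟩
    · exact .inl ⟨1, 1, by norm_num⟩
    · exact .inr ⟨1, 0, by norm_num⟩
    · exact .inr ⟨1, 1, by norm_num⟩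
    · exact .inl ⟨0, 1, by norm_num⟩
    · exact .inl ⟨2, 1, by norm_num⟩
    · exact .inr ⟨0, 1, by norm_num⟩
    · exact .inr ⟨2, 1, by norm_num⟩
  · refine ⟨2, by norm_num, ?_⟩
    rintro t (rfl | rfl | rfl | rfl | rfl | rfl | rfl | rfl)
    · exact .inl ⟨1, 0, by norm_num⟩
    · exact .inr ⟨0, 1, by norm_num⟩
    · exact .inl ⟨w, 1, by linear_combination (-1) * hw⟩
    · exact .inr ⟨6, w, by linear_combination (-6) * hw⟩
    · exact .inr ⟨2, 0, by norm_num⟩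
    · exact .inl ⟨0, 1, by norm_num⟩
    · exact .inr ⟨2*w, 2, by linear_combination (-4) * hw⟩
    · exact .inl ⟨6, w, by linear_combination (-6) * hw⟩

theorem nm_index (a : ℚ_[2]) (ha0 : a ≠ 0) (ha : ∀ k, a ≠ k^2) (b t : ℚ_[2]) (hb0 : b ≠ 0)
    (ht0 : t ≠ 0) (hb : ¬ IsNm a b) : IsNm a t ∨ IsNm a (t*b) := by
  obtain ⟨a', ha', k, hk, rfl⟩ := sq_class a ha0
  have ha'' : a' = 3 ∨ a' = -1 ∨ a' = -3 ∨ a' = 2 ∨ a' = 6 ∨ a' = -2 ∨ a' = -6 := by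
    rcases ha' with rfl | h
    · exact absurd (one_mul _) (ha k)
    · exact h
  obtain ⟨g, hg0, hg⟩ := rep_index a' ha''
  have key : ∀ s : ℚ_[2], s ≠ 0 → IsNm (a'*k^2) s ∨ IsNm (a'*k^2) (g*s) := by
    intro s hs
    obtain ⟨s', hs', l, hl, rfl⟩ := sq_class s hs
    rcases hg s' hs' with h | h
    · left; exact (h.base hk).mul (.sq _ _)
    · right; rw [← mul_assoc]; exact (h.base hk).mul (.sq _ _)
  rcases key t ht0 with h | h
  · exact .inl h
  · right
    have h2 := ((h.mul ((key b hb0).resolve_left hb))).mul (.sq _ (g⁻¹))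
    convert h2 using 1
    field_simp

theorem nm5 (x z : ℚ_[2]) (h : ¬ (x = 0 ∧ z = 0)) : ∃ m : ℚ_[2], m ≠ 0 ∧ ‖x^2 - 5*z^2‖ = ‖m‖^2 := by
  by_cases hz : z = 0
  · subst hz
    exact ⟨x, by simpa using h, by simp⟩
  have h5 : ‖(5:ℚ_[2])‖ = 1 := by
    have := (Padic.norm_intCast_lt_one_iff (p := 2) (k := 5)).not.2 (by norm_num)
    push_cast at this
    exact le_antisymm (by simpa using Padic.norm_int_le_one (p := 2) 5) (not_lt.1 this)
  suffices H : ∀ w : ℚ_[2], ∃ m : ℚ_[2], m ≠ 0 ∧ ‖w^2 - 5‖ = ‖m‖^2 by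
    obtain ⟨m, hm, h⟩ := H (x/z)
    refine ⟨m*z, mul_ne_zero hm hz, ?_⟩
    rw [norm_mul, mul_pow, ← h, ← norm_pow, ← norm_mul]
    congr 1; field_simp
  intro w
  rcases lt_trichotomy ‖w‖ 1 with hw | hw | hw
  · refine ⟨1, one_ne_zero, ?_⟩
    have : ‖w^2‖ < ‖(5:ℚ_[2])‖ := by
      rw [h5, norm_pow]; exact pow_lt_one₀ (norm_nonneg _) hw two_ne_zero
    rw [sub_eq_add_neg, Padic.add_eq_max_of_ne (by rw [norm_neg]; exact this.ne), norm_neg,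
      max_eq_right this.le, h5]; simp
  · refine ⟨2, two_ne_zero, ?_⟩
    have h8 : ‖w^2 - 1‖ ≤ 1/8 := by
      obtain ⟨u, rfl⟩ : ∃ u : ℤ_[2], (u:ℚ_[2]) = w := ⟨⟨w, hw.le⟩, rfl⟩
      have e : ∀ n : ℤ_[2], ‖u - n‖ ≤ 1/8 → ‖n^2-1‖ ≤ 1/8 → ‖u^2-1‖ ≤ 1/8 := by
        intro n h1 h2
        have : u^2 - 1 = (u-n)*(u+n) + (n^2-1) := by ring
        rw [this]
        refine (PadicInt.nonarchimedean _ _).trans (max_le ?_ h2)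
        rw [norm_mul]
        nlinarith [norm_nonneg (u - n), norm_nonneg (u+n), PadicInt.norm_le_one (u+n)]
      have h2 : ‖(2:ℤ_[2])‖ = 1/2 := by
        have := PadicInt.norm_p (p := 2); norm_num at this ⊢; exact this
      have h8 : ‖(8:ℤ_[2])‖ ≤ 1/8 := by
        rw [show (8:ℤ_[2]) = 2^3 by norm_num, norm_pow, h2]; norm_num
      have : ‖u^2-1‖ ≤ 1/8 := by
        rcases unit_mod8 u hw with h | h | h | h
        · exact e _ h (by norm_num)
        · exact e _ h (by norm_num; simpa using h8)
        · exact e _ h (by norm_num)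
        · exact e _ h (by norm_num; simpa using h8)
      exact_mod_cast this
    have h4 : ‖(-4 : ℚ_[2])‖ = 1/4 := by
      rw [norm_neg, show (4:ℚ_[2]) = 2^2 by norm_num, norm_pow, norm2]; norm_num
    rw [show w^2 - 5 = (w^2-1) + (-4) by ring, Padic.add_eq_max_of_ne (by rw [h4]; linarith),
      h4, norm2, max_eq_right (by linarith)]
    norm_num
  · refine ⟨w, by rintro rfl; norm_num at hw, ?_⟩
    have : ‖(5:ℚ_[2])‖ < ‖w^2‖ := by
      rw [h5, norm_pow]; exact one_lt_pow₀ hw two_ne_zero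
    rw [sub_eq_add_neg, Padic.add_eq_max_of_ne (by rw [norm_neg]; exact this.ne'), norm_neg,
      max_eq_left this.le, norm_pow]

theorem qN_ne_zero {q : D} (hq : q ≠ 0) : qN q ≠ 0 := by
  intro h
  rw [qN_eq] at h
  have h1 : q.re^2 - 5*q.imJ^2 = 2 * (q.imI^2 - 5*q.imK^2) := by linear_combination h
  have nz : ∀ x z : ℚ_[2], x^2 - 5*z^2 = 0 → x = 0 ∧ z = 0 := by
    intro x z hxz
    by_contra hc
    obtain ⟨m, hm, h⟩ := nm5 x z hc
    rw [hxz, norm_zero] at h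
    exact hm (by simpa using h.symm)
  by_cases hA : q.re = 0 ∧ q.imJ = 0
  · rw [hA.1, hA.2] at h1
    obtain ⟨h2, h3⟩ := nz q.imI q.imK (by linear_combination -h1/2)
    exact hq (by ext <;> simp [hA, h2, h3])
  by_cases hB : q.imI = 0 ∧ q.imK = 0
  · rw [hB.1, hB.2] at h1
    exact hA (nz _ _ (by rw [h1]; ring))
  obtain ⟨m, hm, h2⟩ := nm5 _ _ hA
  obtain ⟨n, hn, h3⟩ := nm5 _ _ hB
  rw [h1, norm_mul, norm2, h3, Padic.norm_eq_zpow_neg_valuation hm,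
    Padic.norm_eq_zpow_neg_valuation hn] at h2
  push_cast at h2
  rw [one_div, ← zpow_neg_one, ← zpow_natCast, ← zpow_natCast, ← zpow_mul, ← zpow_mul,
    ← zpow_add₀ (by norm_num)] at h2
  have := zpow_right_injective₀ (by norm_num) (by norm_num) h2
  push_cast at this
  omega

/-- An auxiliary pure quaternion anticommuting with `a`. -/
theorem exists_anti (a : D) (ha : star a = -a) : ∃ e : D, e ≠ 0 ∧ star e = -e ∧ e * a = -(a * e) := by
  have h0 : a.re = 0 := by
    have := congrArg QuaternionAlgebra.re ha
    simp at this
    linear_combination this/2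
  by_cases h : a.imI = 0 ∧ a.imJ = 0
  · refine ⟨⟨0,1,0,0⟩, ?_, ?_, ?_⟩
    · intro h; simpa using congrArg QuaternionAlgebra.imI h
    · ext <;> simp
    · ext <;> simp [h0, h.1, h.2]
  · refine ⟨⟨0,5*a.imJ,-2*a.imI,0⟩, ?_, ?_, ?_⟩
    · intro h'; apply h
      have h1 := congrArg QuaternionAlgebra.imI h'
      have h2 := congrArg QuaternionAlgebra.imJ h'
      simp at h1 h2
      exact ⟨h2, h1⟩
    · ext <;> simp
    · ext <;> simp [h0] <;> ring

theorem pure_sq (a : D) (ha : star a = -a) : a * a = (-qN a) • (1:D) := by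
  have := mul_star_q a
  rw [ha, mul_neg] at this
  rw [neg_smul, ← this, neg_neg]

theorem qN_lin (a : D) (ha : star a = -a) (x y : ℚ_[2]) :
    qN (x • 1 + y • a) = x^2 - (-qN a) * y^2 := by
  have h0 : a.re = 0 := by
    have := congrArg QuaternionAlgebra.re ha
    simp at this
    linear_combination this/2
  simp only [qN_eq]
  simp [h0]
  ring

theorem pure_re (a : D) (ha : star a = -a) : a.re = 0 := by
  have := congrArg QuaternionAlgebra.re ha
  simp at this
  linear_combination this/2

theorem eq_zero_of_qN {q : D} (h : qN q = 0) : q = 0 := by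
  by_contra hq
  exact qN_ne_zero hq h

theorem qmul_ne {p q : D} (hp : p ≠ 0) (hq : q ≠ 0) : p * q ≠ 0 := by
  intro h
  have := qN_mul p q
  rw [h] at this
  apply mul_ne_zero (qN_ne_zero hp) (qN_ne_zero hq)
  rw [← this, qN_eq]; simp

theorem not_sq (a : D) (ha : star a = -a) (ha0 : a ≠ 0) (k : ℚ_[2]) : -qN a ≠ k^2 := by
  intro h
  have h1 : qN (k • 1 + (1:ℚ_[2]) • a) = 0 := by rw [qN_lin a ha]; linear_combination -h
  have h2 := eq_zero_of_qN h1
  have h3 := congrArg QuaternionAlgebra.re h2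
  simp [pure_re a ha] at h3
  apply ha0
  simpa [h3] using h2

theorem not_nm (a e : D) (ha : star a = -a) (ha0 : a ≠ 0) (he : star e = -e) (he0 : e ≠ 0)
    (hea : e * a = -(a * e)) : ¬ IsNm (-qN a) (-qN e) := by
  rintro ⟨x, y, h⟩
  have h1 : qN (x • 1 + y • a + e) = 0 := by
    have h3 := congrArg QuaternionAlgebra.re hea
    have h4 := pure_re a ha
    have h5 := pure_re e he
    simp only [qN_eq] at h ⊢
    simp [h4, h5] at h h3 ⊢
    linear_combination -h - y * h3
  have h2 := eq_zero_of_qN h1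
  have h3 : e = -(x • 1 + y • a) := by rw [eq_neg_iff_add_eq_zero, add_comm]; exact h2
  have h4 : e * a = a * e := by
    rw [h3]; simp [mul_add, add_mul]
  rw [h4] at hea
  have h5 : (2:ℚ_[2]) • (a * e) = 0 := by
    rw [two_smul]; nth_rewrite 1 [hea]; simp
  exact qmul_ne ha0 he0 ((smul_eq_zero.1 h5).resolve_left two_ne_zero)

theorem conj_eq (p a z : D) (ε : ℚ_[2]) (h : p * a = ε • (z * p)) :
    p * a * star p = (ε * qN p) • z := by
  rw [h, smul_mul_assoc, mul_assoc, mul_star_q, mul_smul_comm, mul_one, smul_smul]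

theorem exists_mu (a z : D) (ha : star a = -a) (ha0 : a ≠ 0) (hz : star z = -z)
    (h : qN z = qN a) : ∃ μ : D, μ ≠ 0 ∧ μ * a = z * μ := by
  by_cases h0 : z + a = 0
  · obtain ⟨e, he0, -, he⟩ := exists_anti a ha
    refine ⟨e, he0, ?_⟩
    rw [eq_neg_of_add_eq_zero_left h0, he, neg_mul]
  · refine ⟨z + a, h0, ?_⟩
    rw [add_mul, mul_add, pure_sq a ha, pure_sq z hz, h, add_comm]

theorem exists_lam (a z : D) (ha : star a = -a) (ha0 : a ≠ 0) (hz : star z = -z)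
    (c : ℚ_[2]) (hc : c ≠ 0) (h : qN z * qN a = c^2) :
    ∃ l : D, l * a * star l = z := by
  have hNa := qN_ne_zero ha0
  obtain ⟨s, hs⟩ : ∃ s, s = c / qN a := ⟨_, rfl⟩
  have hs0 : s ≠ 0 := by rw [hs]; exact div_ne_zero hc hNa
  have hzz : qN (s⁻¹ • z) = qN a := by
    rw [qN_smul, hs]; field_simp; linear_combination h
  obtain ⟨μ, hμ0, hμ⟩ := exists_mu a (s⁻¹ • z) ha ha0 (by
    ext <;> simp [pure_re z hz]) hzz
  obtain ⟨e, he0, he, hea⟩ := exists_anti a ha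
  have hNμ := qN_ne_zero hμ0
  have hNe := qN_ne_zero he0
  have comm : ∀ x y : ℚ_[2], (x • 1 + y • a) * a = a * (x • 1 + y • a) := by
    intro x y; simp [mul_add, add_mul]
  have hμν : ∀ x y : ℚ_[2], (μ * (x • 1 + y • a)) * a = (s⁻¹ • z) * (μ * (x • 1 + y • a)) := by
    intro x y
    rw [mul_assoc, comm, ← mul_assoc, hμ, mul_assoc]
  rcases nm_index (-qN a) (neg_ne_zero.2 hNa) (not_sq a ha ha0) (-qN e) (s / qN μ)
    (neg_ne_zero.2 hNe) (div_ne_zero hs0 hNμ) (not_nm a e ha ha0 he he0 hea) with ⟨x, y, hxy⟩ | ⟨x, y, hxy⟩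
  · refine ⟨μ * (x • 1 + y • a), ?_⟩
    rw [conj_eq _ a (s⁻¹ • z) 1 (by rw [one_smul, hμν]), qN_mul, qN_lin a ha, ← hxy, smul_smul,
      show 1 * (qN μ * (s / qN μ)) * s⁻¹ = 1 by field_simp, one_smul]
  · refine ⟨(qN e)⁻¹ • (μ * (x • 1 + y • a) * e), ?_⟩
    rw [conj_eq _ a (s⁻¹ • z) (-1) (by
        rw [smul_mul_assoc, mul_assoc, hea, mul_neg, ← mul_assoc, hμν, mul_smul_comm, smul_neg,
          neg_smul, one_smul, mul_assoc (s⁻¹ • z)]),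
      qN_smul, qN_mul, qN_mul, qN_lin a ha, ← hxy, smul_smul]
    rw [show -1 * ((qN e)⁻¹ ^ 2 * (qN μ * (s / qN μ * -qN e) * qN e)) * s⁻¹ = 1 by field_simp, one_smul]

theorem stmt_3 (r a₁ a₂ : D) (hr0 : r ≠ 0) (hr : ‖qN r‖ ≤ 1)
    (ha₁0 : a₁ ≠ 0) (ha₁pure : star a₁ = -a₁) (ha₁ : ‖qN a₁‖ ≤ 1)
    (ha₂0 : a₂ ≠ 0) (ha₂pure : star a₂ = -a₂) (ha₂ : ‖qN a₂‖ ≤ 1) :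
    (∃ lam : D, lam ≠ 0 ∧ ‖qN lam‖ ≤ 1 ∧
        a₁ = r * a₁ * star r + lam * a₂ * star lam) ↔
      ((∃ c : ℚ_[2], c ≠ 0 ∧ qN (a₁ - r * a₁ * star r) * qN a₂ = c ^ 2) ∧
        ‖qN (a₁ - r * a₁ * star r)‖ ≤ ‖qN a₂‖) := by
  have hz : star (a₁ - r * a₁ * star r) = -(a₁ - r * a₁ * star r) := by
    rw [star_sub, star_mul, star_mul, star_star, ha₁pure, neg_mul, mul_neg, mul_assoc, neg_sub,
      neg_sub_neg]
  have hNa := qN_ne_zero ha₂0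
  constructor
  · rintro ⟨l, hl0, hl, h⟩
    have hN : qN (a₁ - r * a₁ * star r) = qN l ^ 2 * qN a₂ := by
      rw [sub_eq_of_eq_add' h, qN_mul, qN_mul, qN_star]; ring
    rw [hN]
    refine ⟨⟨qN l * qN a₂, mul_ne_zero (qN_ne_zero hl0) hNa, by ring⟩, ?_⟩
    rw [norm_mul, norm_pow]
    exact mul_le_of_le_one_left (norm_nonneg _) (pow_le_one₀ (norm_nonneg _) hl)
  · rintro ⟨⟨c, hc, h⟩, hle⟩
    obtain ⟨l, hl⟩ := exists_lam a₂ _ ha₂pure ha₂0 hz c hc h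
    have hN : qN (a₁ - r * a₁ * star r) = qN l ^ 2 * qN a₂ := by
      rw [← hl, qN_mul, qN_mul, qN_star]; ring
    refine ⟨l, ?_, ?_, ?_⟩
    · rintro rfl
      apply hc
      rw [hN] at h
      have h0 : qN (0 : D) = 0 := by rw [qN_eq]; simp
      rw [h0] at h
      simpa using h.symm
    · rw [hN, norm_mul, norm_pow] at hle
      have hp : 0 < ‖qN a₂‖ := norm_pos_iff.2 hNa
      have : ‖qN l‖ ^ 2 ≤ 1 := by
        by_contra hcon
        nlinarith
      nlinarith [norm_nonneg (qN l)]
    · rw [hl]; abel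
end
end

section
/- For each a₁ ∈ {j + i·j, i + j} ⊆ ℍ[ℚ₂, 2, 5] and each t ∈ {1, 2}, there exists r ∈ O_D satisfying the k-star conditions for (a₁, t). -/
open Quaternion

noncomputable section

/-- `r` satisfies the k-star conditions for `(a₁, t)`: with `z = a₁ - r·a₁·(star r)`,
(i) `N(1-r)` is not represented by `x² + N(a₁)·y²` over `ℚ₂` (Hilbert symbol `-1`),
(ii) `N(z)·N(a₁)` is a nonzero square, and (iii) `‖N(z)‖ ≤ 2^(-2t)·‖N(a₁)‖`. -/
def kStar (a₁ : D) (t : ℕ) (r : D) : Prop :=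
  (¬ ∃ x y : ℚ_[2], qN (1 - r) = x ^ 2 + qN a₁ * y ^ 2) ∧
  (∃ c : ℚ_[2], c ≠ 0 ∧ qN (a₁ - r * a₁ * star r) * qN a₁ = c ^ 2) ∧
  ‖qN (a₁ - r * a₁ * star r)‖ ≤ (2 : ℝ) ^ (-(2 * (t : ℤ))) * ‖qN a₁‖

lemma aux_int (a b : ℤ_[2]) (ha : PadicInt.toZModPow 2 a = 1) (hb : PadicInt.toZModPow 2 b = 3)
    (u v w : ℤ_[2]) (h : u ^ 2 + a * v ^ 2 = b * w ^ 2) : ¬ (u = 1 ∨ v = 1 ∨ w = 1) := by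
  have key : ∀ p q s : ZMod (2 ^ 2), p ^ 2 + 1 * q ^ 2 = 3 * s ^ 2 →
      ¬ (p = 1 ∨ q = 1 ∨ s = 1) := by decide
  have h2 := congrArg (PadicInt.toZModPow (p := 2) 2) h
  simp only [map_add, map_mul, map_pow, ha, hb] at h2
  have := key _ _ _ h2
  rintro (h | h | h) <;> apply this <;> simp [h]

lemma aux_rat (a b : ℤ_[2]) (ha : PadicInt.toZModPow 2 a = 1) (hb : PadicInt.toZModPow 2 b = 3)
    (u v w : ℚ_[2]) (h : u ^ 2 + a * v ^ 2 = b * w ^ 2)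
    (hu : ‖u‖ ≤ 1) (hv : ‖v‖ ≤ 1) (hw : ‖w‖ ≤ 1) : ¬ (u = 1 ∨ v = 1 ∨ w = 1) := by
  have := aux_int a b ha hb ⟨u, hu⟩ ⟨v, hv⟩ ⟨w, hw⟩ (by
    apply Subtype.ext
    push_cast
    exact h)
  intro h'
  apply this
  rcases h' with h' | h' | h'
  · left; exact Subtype.ext h'
  · right; left; exact Subtype.ext h'
  · right; right; exact Subtype.ext h'

lemma aux_main_s9 (a b : ℤ_[2]) (ha : PadicInt.toZModPow 2 a = 1) (hb : PadicInt.toZModPow 2 b = 3)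
    (x y : ℚ_[2]) (h : x ^ 2 + a * y ^ 2 = b) : False := by
  have hd : ∀ s t : ℚ_[2], t ≠ 0 → ‖s‖ ≤ ‖t‖ → ‖s / t‖ ≤ 1 := by
    intro s t ht hst
    rw [norm_div]
    exact div_le_one_of_le₀ hst (norm_nonneg _)
  have hz : ∀ s : ℚ_[2], s ≠ 0 →
      (x / s) ^ 2 + a * (y / s) ^ 2 = b * (1 / s) ^ 2 := by
    intro s hs
    rw [← h]; field_simp
  have fin : ∀ s : ℚ_[2], s ≠ 0 → ‖x‖ ≤ ‖s‖ → ‖y‖ ≤ ‖s‖ → ‖(1 : ℚ_[2])‖ ≤ ‖s‖ →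
      ¬ (x / s = 1 ∨ y / s = 1 ∨ 1 / s = 1) := fun s hs h1 h2 h3 =>
    aux_rat a b ha hb _ _ _ (hz s hs) (hd _ _ hs h1) (hd _ _ hs h2) (hd _ _ hs h3)
  have pos : ∀ s : ℚ_[2], ‖(1 : ℚ_[2])‖ ≤ ‖s‖ → s ≠ 0 := by
    rintro s hs rfl
    norm_num at hs
  rcases le_total ‖x‖ ‖y‖ with h1 | h1
  · rcases le_total ‖y‖ ‖(1 : ℚ_[2])‖ with h2 | h2
    · exact fin 1 one_ne_zero (h1.trans h2) h2 le_rfl (by simp)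
    · exact fin y (pos y h2) h1 le_rfl h2 (by simp [pos y h2])
  · rcases le_total ‖x‖ ‖(1 : ℚ_[2])‖ with h2 | h2
    · exact fin 1 one_ne_zero h2 (h1.trans h2) le_rfl (by simp)
    · exact fin x (pos x h2) le_rfl h1 h2 (by simp [pos x h2])

lemma aux_norm16 (m : ℤ) (t : ℕ) (ht : t = 1 ∨ t = 2) :
    ‖(16 : ℚ_[2]) * m‖ ≤ (2 : ℝ) ^ (-(2 * (t : ℤ))) * ‖(m : ℚ_[2])‖ := by
  have h2 : ‖(2 : ℚ_[2])‖ = 2⁻¹ := by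
    simpa using Padic.norm_p (p := 2)
  have h16 : (16 : ℚ_[2]) = 2 ^ 4 := by norm_num
  rw [norm_mul, h16, norm_pow, h2]
  apply mul_le_mul_of_nonneg_right _ (norm_nonneg _)
  rcases ht with rfl | rfl <;> norm_num [zpow_neg] <;> norm_cast

lemma qN_mk (a b c d : ℚ_[2]) :
    qN ⟨a, b, c, d⟩ = a ^ 2 - 2 * b ^ 2 - 5 * c ^ 2 + 10 * d ^ 2 := by
  simp [qN]; ring

lemma case1 : qj + qi * qj = (⟨0, 0, 1, 1⟩ : D) := by
  ext <;> simp [qi, qj]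

lemma case2 : qi + qj = (⟨0, 1, 1, 0⟩ : D) := by
  ext <;> simp [qi, qj]

lemma z1 : (⟨0, 0, 1, 1⟩ : D) - ⟨-1, -1, 0, -1⟩ * ⟨0, 0, 1, 1⟩ * star (⟨-1, -1, 0, -1⟩ : D)
    = ⟨0, -30, 4, -14⟩ := by
  ext <;> simp <;> norm_num

lemma z2 : (⟨0, 1, 1, 0⟩ : D) - ⟨-1, -7, 0, 3⟩ * ⟨0, 1, 1, 0⟩ * star (⟨-1, -7, 0, 3⟩ : D)
    = ⟨0, 218, -20, -98⟩ := by
  ext <;> simp <;> norm_num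

lemma o1 : (1 : D) - ⟨-1, -1, 0, -1⟩ = ⟨2, 1, 0, 1⟩ := by
  ext <;> simp <;> norm_num

lemma o2 : (1 : D) - ⟨-1, -7, 0, 3⟩ = ⟨2, 7, 0, -3⟩ := by
  ext <;> simp <;> norm_num

/-- For `a₁ ∈ {j + i·j, i + j}` and `t ∈ {1, 2}` there exists `r ∈ O_D`
satisfying the k-star conditions for `(a₁, t)`. -/
theorem stmt_9 (a₁ : D) (ha₁ : a₁ = qj + qi * qj ∨ a₁ = qi + qj)
    (t : ℕ) (ht : t = 1 ∨ t = 2) :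
    ∃ r : D, ‖qN r‖ ≤ 1 ∧ kStar a₁ t r := by
  rcases ha₁ with rfl | rfl
  · rw [case1]
    refine ⟨⟨-1, -1, 0, -1⟩, ?_, ?_, ?_, ?_⟩
    · rw [qN_mk]
      have := Padic.norm_int_le_one (p := 2) 9
      convert this using 2; norm_num
    · rw [o1, qN_mk, qN_mk]
      rintro ⟨x, y, h⟩
      refine aux_main_s9 5 3 (by rw [map_ofNat]; decide) (by rw [map_ofNat]) (x / 2) (y / 2) ?_
      have e5 : ((5 : ℤ_[2]) : ℚ_[2]) = 5 := rfl
      have e3 : ((3 : ℤ_[2]) : ℚ_[2]) = 3 := rfl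
      rw [e5, e3]
      linear_combination (-1 / 4) * h
    · rw [z1, qN_mk, qN_mk]
      exact ⟨20, by norm_num, by norm_num⟩
    · rw [z1, qN_mk, qN_mk]
      convert aux_norm16 5 t ht using 2 <;> norm_num
  · rw [case2]
    refine ⟨⟨-1, -7, 0, 3⟩, ?_, ?_, ?_, ?_⟩
    · rw [qN_mk]
      have := Padic.norm_int_le_one (p := 2) (-7)
      convert this using 2; norm_num
    · rw [o2, qN_mk, qN_mk]
      rintro ⟨x, y, h⟩
      refine aux_main_s9 (-7) (-1) (by rw [map_neg, map_ofNat]; decide)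
        (by rw [map_neg, map_one]; decide) (x / 2) (y / 2) ?_
      have e7 : ((-7 : ℤ_[2]) : ℚ_[2]) = -7 := rfl
      have e1 : ((-1 : ℤ_[2]) : ℚ_[2]) = -1 := rfl
      rw [e7, e1]
      linear_combination (-1 / 4) * h
    · rw [z2, qN_mk, qN_mk]
      exact ⟨84, by norm_num, by norm_num⟩
    · rw [z2, qN_mk, qN_mk]
      have h63 : ‖((-1008 : ℤ) : ℚ_[2])‖ = ‖(16 : ℚ_[2]) * ((-7 : ℤ) : ℚ_[2])‖ := by
        have h9 : ‖((9 : ℤ) : ℚ_[2])‖ = 1 := by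
          rw [Padic.norm_intCast_eq_one_iff]
          norm_num
        have : ((-1008 : ℤ) : ℚ_[2]) = ((9 : ℤ) : ℚ_[2]) * (16 * ((-7 : ℤ) : ℚ_[2])) := by
          norm_num
        rw [this, norm_mul, h9, one_mul]
      have := h63.le.trans (aux_norm16 (-7) t ht)
      have ea : (0 ^ 2 - 2 * 218 ^ 2 - 5 * (-20) ^ 2 + 10 * (-98) ^ 2 : ℚ_[2]) =
        ((-1008 : ℤ) : ℚ_[2]) := by norm_num
      have eb : (0 ^ 2 - 2 * 1 ^ 2 - 5 * 1 ^ 2 + 10 * 0 ^ 2 : ℚ_[2]) = ((-7 : ℤ) : ℚ_[2]) := by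
        norm_num
      rw [ea, eb]
      exact this
end
end

section
/- Let π ∈ {2, −2, 10, −10} ⊆ ℚ₂ and let a₁ ∈ ℍ[ℚ₂, 2, 5] be any pure quaternion of the form a₁ = c·i + d·(i·j) with c, d ∈ ℚ₂ satisfying a₁·a₁ = π (as a scalar; equivalently N(a₁) = −π). Then for each t ∈ {1, 2, 3, 4} there exists r ∈ O_D satisfying the k-star conditions for (a₁, t). -/
open Quaternion

noncomputable section

theorem aux_rep (u p e : ℤ) (hp : p = 2 * e) (he : e % 2 = 1) (hu : u % 8 = 5)
    (X Y : ℚ_[2]) (h : (u : ℚ_[2]) = X ^ 2 - (p : ℚ_[2]) * Y ^ 2) : False := by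
  have hu1 : ‖(u : ℚ_[2])‖ = 1 := by
    have h1 := Padic.norm_int_le_one (p := 2) u
    have h2 : ¬ ‖(u : ℚ_[2])‖ < 1 := by
      rw [Padic.norm_intCast_lt_one_iff]; push_cast; omega
    linarith [not_lt.mp h2]
  have he1 : ‖(e : ℚ_[2])‖ = 1 := by
    have h1 := Padic.norm_int_le_one (p := 2) e
    have h2 : ¬ ‖(e : ℚ_[2])‖ < 1 := by
      rw [Padic.norm_intCast_lt_one_iff]; push_cast; omega
    linarith [not_lt.mp h2]
  have h2n : ‖(2 : ℚ_[2])‖ = 2⁻¹ := by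
    have := Padic.norm_p (p := 2); exact_mod_cast this
  have hpn : ‖(p : ℚ_[2])‖ = 2⁻¹ := by
    rw [hp]; push_cast; rw [norm_mul, he1, h2n, mul_one]
  have hY : ‖Y‖ ≤ 1 := by
    by_contra hY
    have hY := not_le.mp hY
    have hY0 : Y ≠ 0 := by rintro rfl; norm_num at hY
    obtain ⟨w, hw⟩ := Padic.padicNormE.image (p := 2) hY0
    have hw' : ‖Y‖ = (2:ℝ) ^ (-w) := by rw [hw]; push_cast; rfl
    have hw0 : 1 ≤ -w := by
      rw [hw'] at hY
      have := (one_lt_zpow_iff_right₀ (by norm_num : (1:ℝ) < 2)).mp hY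
      omega
    have hb : ‖(p : ℚ_[2]) * Y ^ 2‖ = (2:ℝ) ^ (-1 + 2 * (-w)) := by
      rw [norm_mul, norm_pow, hpn, hw', zpow_add₀ (by norm_num), zpow_mul']
      rw [zpow_neg_one]; norm_cast
    have hX : X ^ 2 = (u : ℚ_[2]) + (p : ℚ_[2]) * Y ^ 2 := by rw [h]; ring
    have hgt : 1 < ‖(p : ℚ_[2]) * Y ^ 2‖ := by
      rw [hb]; exact one_lt_zpow₀ (by norm_num) (by omega)
    have hXn : ‖X‖ ^ 2 = (2:ℝ) ^ (-1 + 2 * (-w)) := by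
      rw [← norm_pow, hX, Padic.add_eq_max_of_ne (by rw [hu1]; exact hgt.ne), hu1,
        max_eq_right hgt.le, hb]
    have hX0 : X ≠ 0 := by
      rintro rfl
      have : (0:ℝ) < (2:ℝ) ^ (-1 + 2 * (-w)) := by positivity
      rw [← hXn] at this; norm_num at this
    obtain ⟨v, hv⟩ := Padic.padicNormE.image (p := 2) hX0
    have hv' : ‖X‖ = (2:ℝ) ^ (-v) := by rw [hv]; push_cast; rfl
    rw [hv', ← zpow_natCast, ← zpow_mul] at hXn
    have := zpow_right_injective₀ (by norm_num : (0:ℝ) < 2) (by norm_num) hXn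
    push_cast at this
    omega
  have hXi : ‖X‖ ≤ 1 := by
    have hX : X ^ 2 = (u : ℚ_[2]) + (p : ℚ_[2]) * Y ^ 2 := by rw [h]; ring
    have h1 : ‖X‖ ^ 2 ≤ 1 := by
      rw [← norm_pow, hX]
      refine (Padic.nonarchimedean _ _).trans (max_le hu1.le ?_)
      rw [norm_mul, norm_pow, hpn]
      have : ‖Y‖ ^ 2 ≤ 1 := pow_le_one₀ (norm_nonneg _) hY
      linarith
    exact (pow_le_one_iff_of_nonneg (norm_nonneg _) (by norm_num)).mp h1
  let x : ℤ_[2] := ⟨X, hXi⟩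
  let y : ℤ_[2] := ⟨Y, hY⟩
  have hz : (u : ℤ_[2]) = x ^ 2 - (p : ℤ_[2]) * y ^ 2 := by
    apply Subtype.ext; push_cast; exact h
  have hm := congrArg (PadicInt.toZModPow (p := 2) 3) hz
  simp only [map_sub, map_mul, map_pow, map_intCast] at hm
  generalize PadicInt.toZModPow (p := 2) 3 x = a at hm
  generalize PadicInt.toZModPow (p := 2) 3 y = b at hm
  have hu8 : (u : ZMod (2 ^ 3)) = 5 := by
    have : ((u : ℤ) : ZMod (2^3)) = ((5 : ℤ) : ZMod (2^3)) := by
      rw [ZMod.intCast_eq_intCast_iff]; change u % 8 = 5 % 8; omega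
    simpa using this
  rw [hu8, hp] at hm
  push_cast at hm
  have hE : (e : ZMod (2^3)) = 1 ∨ (e : ZMod (2^3)) = 3 ∨ (e : ZMod (2^3)) = 5 ∨
      (e : ZMod (2^3)) = 7 := by
    have key : ∀ k : ℤ, e % 8 = k % 8 → (e : ZMod (2^3)) = ((k : ℤ) : ZMod (2^3)) := by
      intro k hk; rw [ZMod.intCast_eq_intCast_iff]; exact hk
    have : e % 8 = 1 ∨ e % 8 = 3 ∨ e % 8 = 5 ∨ e % 8 = 7 := by omega
    rcases this with h | h | h | h
    · left; simpa using key 1 h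
    · right; left; simpa using key 3 h
    · right; right; left; simpa using key 5 h
    · right; right; right; simpa using key 7 h
  generalize (e : ZMod (2^3)) = f at hm hE
  revert a b f
  decide

theorem aux_main_s10 (e u : ℤ) (he : e % 2 = 1) (hu : u % 8 = 5) (c d x y z k s : ℚ_[2])
    (hk : k ≠ 0) (hs : s ≠ 0)
    (hcd : 2 * c ^ 2 - 10 * d ^ 2 = ((2 * e : ℤ) : ℚ_[2]))
    (hn : ‖x ^ 2 - ((2 * e : ℤ) : ℚ_[2]) * y ^ 2 - 5 * z ^ 2‖ ≤ 1)
    (hm : ((1 - x) ^ 2 - ((2 * e : ℤ) : ℚ_[2]) * y ^ 2 - 5 * z ^ 2) * k ^ 2 = u)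
    (hF : (1 - (x ^ 2 - ((2 * e : ℤ) : ℚ_[2]) * y ^ 2 - 5 * z ^ 2)) ^ 2 - 20 * z ^ 2 = (16 * s) ^ 2)
    (hs1 : ‖s‖ ≤ 1) (t : ℕ) (ht : t ≤ 4) :
    ∃ r : D, ‖qN r‖ ≤ 1 ∧ kStar ⟨0, c, 0, d⟩ t r := by
  have hNa : qN ⟨0, c, 0, d⟩ = -((2 * e : ℤ) : ℚ_[2]) := by
    rw [← hcd]; simp [qN]; ring
  have he0 : ((2 * e : ℤ) : ℚ_[2]) ≠ 0 := by
    rw [Int.cast_ne_zero]; omega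
  set P : ℚ_[2] := ((2 * e : ℤ) : ℚ_[2]) with hP
  have hNr : qN ⟨x, y * c, z, y * d⟩ = x ^ 2 - P * y ^ 2 - 5 * z ^ 2 := by
    rw [← hcd]; simp [qN]; ring
  have hN1 : qN (1 - ⟨x, y * c, z, y * d⟩) = (1 - x) ^ 2 - P * y ^ 2 - 5 * z ^ 2 := by
    rw [← hcd]; simp [qN]; ring
  have hNz : qN ((⟨0, c, 0, d⟩ : D) - ⟨x, y * c, z, y * d⟩ * ⟨0, c, 0, d⟩ *
      star ⟨x, y * c, z, y * d⟩) = -P * (16 * s) ^ 2 := by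
    rw [← hF, ← hcd]; simp [qN]; ring
  refine ⟨⟨x, y * c, z, y * d⟩, by rw [hNr]; exact hn, ?_, ?_, ?_⟩
  · rintro ⟨X, Y, hXY⟩
    rw [hN1, hNa] at hXY
    refine aux_rep u (2 * e) e rfl he hu (X * k) (Y * k) ?_
    rw [← hm, hXY]; ring
  · refine ⟨P * (16 * s), by simp [he0, hs], ?_⟩
    rw [hNz, hNa]; ring
  · rw [hNz, hNa, norm_mul, mul_comm]
    refine mul_le_mul_of_nonneg_right ?_ (norm_nonneg _)
    have h2n : ‖(2 : ℚ_[2])‖ = 2⁻¹ := by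
      have := Padic.norm_p (p := 2); exact_mod_cast this
    have h16 : ‖(16 : ℚ_[2])‖ = (2⁻¹) ^ 4 := by
      rw [← h2n, ← norm_pow]; norm_num
    have h1 : ‖(16 * s) ^ 2‖ ≤ (2:ℝ) ^ (-8 : ℤ) := by
      rw [norm_pow, norm_mul, h16]
      have : ‖s‖ ^ 2 ≤ 1 := pow_le_one₀ (norm_nonneg _) hs1
      rw [mul_pow]
      norm_num
      linarith
    exact h1.trans (zpow_le_zpow_right₀ (by norm_num) (by omega))

theorem aux_int_s10 (u : ℤ) (h : u % 2 = 1) : ‖(u : ℚ_[2])‖ = 1 := by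
  have h1 := Padic.norm_int_le_one (p := 2) u
  have h2 : ¬ ‖(u : ℚ_[2])‖ < 1 := by
    rw [Padic.norm_intCast_lt_one_iff]; push_cast; omega
  linarith [not_lt.mp h2]

/-- For `π ∈ {2, -2, 10, -10}` and any pure quaternion `a₁ = c·i + d·(i·j)` with
`a₁² = π`, and each `t ∈ {1, 2, 3, 4}`, there exists `r ∈ O_D` satisfying the
k-star conditions for `(a₁, t)`. -/
theorem stmt_10 (pp : ℚ_[2]) (hpp : pp = 2 ∨ pp = -2 ∨ pp = 10 ∨ pp = -10)
    (c d : ℚ_[2]) (a₁ : D)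
    (ha₁ : a₁ = algebraMap ℚ_[2] D c * qi + algebraMap ℚ_[2] D d * (qi * qj))
    (hsq : a₁ * a₁ = algebraMap ℚ_[2] D pp)
    (t : ℕ) (ht : t = 1 ∨ t = 2 ∨ t = 3 ∨ t = 4) :
    ∃ r : D, ‖qN r‖ ≤ 1 ∧ kStar a₁ t r := by
  have hcd : 2 * c ^ 2 - 10 * d ^ 2 = pp := by
    have := congrArg QuaternionAlgebra.re hsq
    rw [ha₁] at this
    simp [qi, qj] at this
    rw [← this]; ring
  have ha : a₁ = ⟨0, c, 0, d⟩ := by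
    rw [ha₁]; ext <;> simp [qi, qj]
  have ht4 : t ≤ 4 := by omega
  rw [ha]
  have h3 : ‖(3 : ℚ_[2])‖ = 1 := by simpa using aux_int_s10 3 rfl
  have h5 : ‖(5 : ℚ_[2])‖ = 1 := by simpa using aux_int_s10 5 rfl
  rcases hpp with rfl | rfl | rfl | rfl
  · refine aux_main_s10 1 (-3) rfl rfl c d (-7/3) (4/3) (4/3) (3/2) (1/3) (by norm_num) (by norm_num)
      (by rw [hcd]; norm_num) ?_ (by norm_num) (by norm_num) (by simp [h3]) t ht4
    have := Padic.norm_int_le_one (p := 2) (-7)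
    convert this using 2; norm_num
  · refine aux_main_s10 (-1) (-3) rfl rfl c d (-5) 4 4 (1/2) 1 (by norm_num) (by norm_num)
      (by rw [hcd]; norm_num) ?_ (by norm_num) (by norm_num) (by simp) t ht4
    have := Padic.norm_int_le_one (p := 2) (-23)
    convert this using 2; norm_num
  · refine aux_main_s10 5 5 rfl rfl c d (-3) 0 (4/5) (5/8) (1/5) (by norm_num) (by norm_num)
      (by rw [hcd]; norm_num) ?_ (by norm_num) (by norm_num) (by simp [h5]) t ht4
    have := Padic.norm_int_le_one (p := 2) 29
    have h : ‖(29 : ℚ_[2]) / 5‖ ≤ 1 := by rw [norm_div, h5, div_one]; exact_mod_cast this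
    convert h using 2; norm_num
  · refine aux_main_s10 (-5) (-11) rfl rfl c d (-5) 8 12 (1/2) 1 (by norm_num) (by norm_num)
      (by rw [hcd]; norm_num) ?_ (by norm_num) (by norm_num) (by simp) t ht4
    have := Padic.norm_int_le_one (p := 2) (-55)
    convert this using 2; norm_num
end
end

section
/- For t ∈ {3, 4} and a₁ ∈ {j + i·j, i + j} ⊆ ℍ[ℚ₂, 2, 5], there is no r = a + b·ω + c·i + d·(i·ω) with integers a, b, c, d satisfying 0 ≤ a, b, c, d < 2^(t+3) (viewed in ℚ₂ via the canonical embedding) that satisfies the k-star conditions for (a₁, t). -/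
open Quaternion

noncomputable section

/-- An integer congruent to 1 mod 8 is a square in `ℚ₂`. -/
lemma sq_of_mod8 (m : ℤ) (hm : m % 8 = 1) : ∃ x : ℚ_[2], (m : ℚ_[2]) = x ^ 2 := by
  have h := @hensels_lemma 2 _ ℤ_[2] _ _ (Polynomial.X ^ 2 - Polynomial.C (m : ℤ_[2])) 1 (by
    have h1 : (8 : ℤ) ∣ 1 - m := by omega
    have h2 : ‖((1 - m : ℤ) : ℤ_[2])‖ ≤ (2 : ℕ) ^ (-(3 : ℕ) : ℤ) := by
      rw [PadicInt.norm_int_le_pow_iff_dvd]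
      exact_mod_cast h1
    have h3 : ‖(2 : ℤ_[2])‖ = 2⁻¹ := by
      have := PadicInt.norm_p (p := 2)
      simpa using this
    have h4 : ‖(1 - m : ℤ_[2])‖ ≤ 1 / 8 := by
      push_cast at h2
      refine h2.trans ?_
      norm_num
    simp only [map_sub, map_pow, Polynomial.aeval_X, Polynomial.aeval_C, Polynomial.derivative_sub,
      Polynomial.derivative_X_pow, Polynomial.derivative_C, one_pow]
    simp only [Algebra.algebraMap_self, RingHom.id_apply]
    refine lt_of_le_of_lt h4 ?_
    simp [h3]
    norm_num)
  obtain ⟨z, hz, -⟩ := h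
  refine ⟨(z : ℚ_[2]), ?_⟩
  simp only [map_sub, map_pow, Polynomial.aeval_X, Polynomial.aeval_C] at hz
  have : z ^ 2 = (m : ℤ_[2]) := by
    simpa [sub_eq_zero] using hz
  have h2 := congrArg (fun w : ℤ_[2] => (w : ℚ_[2])) this
  push_cast at h2
  exact h2.symm

/-- An integer congruent to 1 mod 4 is a norm. -/
lemma norm_of_mod4 (N m : ℤ) (hN : N % 4 = 1) (hm : m % 4 = 1) :
    ∃ x y : ℚ_[2], (m : ℚ_[2]) = x ^ 2 + N * y ^ 2 := by
  rcases (by omega : m % 8 = 1 ∨ m % 8 = 5) with h | h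
  · obtain ⟨x, hx⟩ := sq_of_mod8 m h
    exact ⟨x, 0, by rw [hx]; ring⟩
  · obtain ⟨x, hx⟩ := sq_of_mod8 (m - 4 * N) (by omega)
    refine ⟨x, 2, ?_⟩
    rw [← hx]; push_cast; ring

lemma core (q s N e n α B K : ℤ) (f : ℚ_[2]) (hqs : N = q * s) (hN : N % 4 = 1) (he : 8 ∣ e)
    (hn : q * n = q * α ^ 2 + s * B ^ 2 + 16 * K) (hα : 2 * α = n + e)
    (hf : q * f ^ 2 = q * e ^ 2 + 64 * K) :
    ∃ x y : ℚ_[2], (n : ℚ_[2]) = x ^ 2 + N * y ^ 2 := by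
  have hNodd : Odd N := by rw [Int.odd_iff]; omega
  have hqodd : Odd q := by rw [hqs, Int.odd_mul] at hNodd; exact hNodd.1
  have hsodd : Odd s := by rw [hqs, Int.odd_mul] at hNodd; exact hNodd.2
  have hq0 : (q : ℚ_[2]) ≠ 0 := by
    have : q ≠ 0 := by rintro rfl; simp at hqodd
    exact_mod_cast this
  have hNc : (N : ℚ_[2]) = q * s := by rw [hqs]; push_cast; ring
  obtain ⟨e', rfl⟩ := he
  have hneven : Even n := by rw [Int.even_iff]; omega
  by_cases h16 : 16 ∣ n
  · obtain ⟨n', rfl⟩ := h16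
    obtain ⟨x, y, hxy⟩ := norm_of_mod4 N (1 - 4 * n' - 4 * e') hN (by omega)
    have hm0 : ((1 - 4 * n' - 4 * e' : ℤ) : ℚ_[2]) ≠ 0 := by
      have : (1 - 4 * n' - 4 * e' : ℤ) ≠ 0 := by omega
      exact_mod_cast this
    have hα' : α = 8 * n' + 4 * e' := by omega
    subst hα'
    have hnc := congrArg (fun w : ℤ => (w : ℚ_[2])) hn
    push_cast at hnc hf hm0 hxy
    -- A = f/2, Bb = B/q
    have key : (16 * n' : ℚ_[2]) * (1 - 4 * n' - 4 * e') = (f / 2) ^ 2 + N * (B / q) ^ 2 := by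
      rw [hNc]
      field_simp
      linear_combination 4 * hnc - hf
    set m : ℚ_[2] := 1 - 4 * n' - 4 * e' with hm
    refine ⟨((f / 2) * x + N * (B / q) * y) / m, ((f / 2) * y - (B / q) * x) / m, ?_⟩
    push_cast
    have : (16 * n' : ℚ_[2]) * m ^ 2 = ((f / 2) * x + N * (B / q) * y) ^ 2
        + N * ((f / 2) * y - (B / q) * x) ^ 2 := by
      calc (16 * n' : ℚ_[2]) * m ^ 2 = (16 * n' * m) * m := by ring
        _ = ((f / 2) ^ 2 + N * (B / q) ^ 2) * (x ^ 2 + N * y ^ 2) := by rw [key, ← hxy]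
        _ = _ := by ring
    have h2 : ∀ P Q : ℚ_[2], (P / m) ^ 2 + N * (Q / m) ^ 2 = (P ^ 2 + N * Q ^ 2) / m ^ 2 := by
      intro P Q; ring
    rw [h2, ← this]
    field_simp
  · rcases Int.even_or_odd α with hαe | hαo
    · have hBe : Even B := by
        by_contra hB
        have h1 : Even (q * n) := hneven.mul_left q
        have : Even (s * B ^ 2) := by
          have h2 : s * B ^ 2 = q * n - q * α ^ 2 - 16 * K := by linarith
          rw [h2]
          have h3 : Even (q * α ^ 2) := (hαe.pow_of_ne_zero (by norm_num)).mul_left q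
          have h4 : Even (16 * K) := ⟨8 * K, by ring⟩
          exact (h1.sub h3).sub h4
        rw [Int.even_mul, Int.even_pow] at this
        rcases this with h | h
        · exact (Int.not_even_iff_odd.2 hsodd) h
        · exact hB h.1
      obtain ⟨α1, rfl⟩ := hαe
      obtain ⟨B1, rfl⟩ := hBe
      obtain ⟨n1, rfl⟩ : ∃ n1, n = 4 * n1 := ⟨n / 4, by omega⟩
      have hn1 : q * n1 = q * α1 ^ 2 + s * B1 ^ 2 + 4 * K := by nlinarith
      have hpar : α1 = n1 + 2 * e' := by omega
      obtain ⟨x, y, hxy⟩ := norm_of_mod4 N n1 hN (by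
        have hq2 : q % 4 = 1 ∨ q % 4 = 3 := by have := Int.odd_iff.1 hqodd; omega
        have hs2 : s % 4 = 1 ∨ s % 4 = 3 := by have := Int.odd_iff.1 hsodd; omega
        have hB4 : B1 % 4 = 0 ∨ B1 % 4 = 1 ∨ B1 % 4 = 2 ∨ B1 % 4 = 3 := by omega
        have hn4 : n1 % 4 = 1 ∨ n1 % 4 = 2 ∨ n1 % 4 = 3 := by omega
        have he4 : e' % 2 = 0 ∨ e' % 2 = 1 := by omega
        have ha4 : α1 % 4 = (n1 % 4 + 2 * (e' % 2)) % 4 := by omega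
        have h4 : (q * n1) % 4 = (q * α1 ^ 2 + s * B1 ^ 2) % 4 := by omega
        rcases hq2 with h1 | h1 <;> rcases hs2 with h2 | h2 <;> rcases hB4 with h3 | h3 | h3 | h3 <;>
          rcases hn4 with h5 | h5 | h5 <;> rcases he4 with h6 | h6 <;>
          simp only [h5, h6, Int.reduceMul, Int.reduceAdd, Int.reduceMod] at ha4 <;>
          simp [Int.add_emod, Int.mul_emod, pow_two, h1, h2, h3, h5, ha4] at h4 ⊢)
      refine ⟨2 * x, 2 * y, ?_⟩
      push_cast
      rw [hxy]; ring
    · obtain ⟨x, hx⟩ := sq_of_mod8 (q ^ 2 * α ^ 2 + 16 * K * q) (by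
        have h2 := Int.eight_dvd_sq_sub_one_of_odd (hqodd.mul hαo)
        have h3 : q ^ 2 * α ^ 2 = (q * α) ^ 2 := by ring
        have h4 : 16 * K * q = 16 * (K * q) := by ring
        omega)
      refine ⟨x / q, B / q, ?_⟩
      have hnc := congrArg (fun w : ℤ => (w : ℚ_[2])) hn
      push_cast at hnc hx
      rw [div_pow, ← hx, hNc]
      field_simp
      linear_combination hnc

lemma sqmod (x : ℤ) : (x % 2 = 0 ∧ (x ^ 2 % 16 = 0 ∨ x ^ 2 % 16 = 4)) ∨
    (x % 2 = 1 ∧ x ^ 2 % 8 = 1) := by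
  rcases Int.even_or_odd x with h | h
  · left
    obtain ⟨k, rfl⟩ := h
    refine ⟨by omega, ?_⟩
    have h1 : (k + k) ^ 2 = 4 * k ^ 2 := by ring
    rcases Int.even_or_odd k with h | h
    · obtain ⟨l, rfl⟩ := h
      have h2 : (l + l) ^ 2 = 4 * l ^ 2 := by ring
      omega
    · have := Int.eight_dvd_sq_sub_one_of_odd h
      omega
  · right
    have := Int.eight_dvd_sq_sub_one_of_odd h
    have := Int.odd_iff.1 h
    omega

/-- descent, first case -/
lemma descent1 (e X Y : ℤ) (h : 64 ∣ e ^ 2 - 2 * (X ^ 2 + 5 * Y ^ 2)) :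
    8 ∣ e ∧ ∃ x y k, X = 4 * x ∧ Y = 4 * y ∧ x ^ 2 + 5 * y ^ 2 = 2 * k := by
  have step : ∀ e X Y : ℤ, 16 ∣ e ^ 2 - 2 * (X ^ 2 + 5 * Y ^ 2) →
      e % 2 = 0 ∧ X % 2 = 0 ∧ Y % 2 = 0 := by
    intro e X Y h
    have h1 := sqmod e
    have h2 := sqmod X
    have h3 := sqmod Y
    omega
  have s1 := step e X Y (by omega)
  obtain ⟨e1, rfl⟩ : ∃ e1, e = 2 * e1 := ⟨e / 2, by omega⟩
  obtain ⟨X1, rfl⟩ : ∃ e1, X = 2 * e1 := ⟨X / 2, by omega⟩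
  obtain ⟨Y1, rfl⟩ : ∃ e1, Y = 2 * e1 := ⟨Y / 2, by omega⟩
  simp only [mul_pow] at h
  have s2 := step e1 X1 Y1 (by omega)
  obtain ⟨e2, rfl⟩ : ∃ e2, e1 = 2 * e2 := ⟨e1 / 2, by omega⟩
  obtain ⟨X2, rfl⟩ : ∃ e2, X1 = 2 * e2 := ⟨X1 / 2, by omega⟩
  obtain ⟨Y2, rfl⟩ : ∃ e2, Y1 = 2 * e2 := ⟨Y1 / 2, by omega⟩
  simp only [mul_pow] at h
  have h1 := sqmod e2
  refine ⟨by omega, X2, Y2, (X2 ^ 2 + 5 * Y2 ^ 2) / 2, by ring, by ring, by omega⟩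

/-- descent, second case -/
lemma descent2 (e X Y : ℤ) (h : 64 ∣ 7 * e ^ 2 - 10 * (X ^ 2 - 7 * Y ^ 2)) :
    8 ∣ e ∧ ∃ x y k, X = 4 * x ∧ Y = 4 * y ∧ x ^ 2 - 7 * y ^ 2 = 2 * k := by
  have step : ∀ e X Y : ℤ, 16 ∣ 7 * e ^ 2 - 10 * (X ^ 2 - 7 * Y ^ 2) →
      e % 2 = 0 ∧ X % 2 = 0 ∧ Y % 2 = 0 := by
    intro e X Y h
    have h1 := sqmod e
    have h2 := sqmod X
    have h3 := sqmod Y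
    omega
  have s1 := step e X Y (by omega)
  obtain ⟨e1, rfl⟩ : ∃ e1, e = 2 * e1 := ⟨e / 2, by omega⟩
  obtain ⟨X1, rfl⟩ : ∃ e1, X = 2 * e1 := ⟨X / 2, by omega⟩
  obtain ⟨Y1, rfl⟩ : ∃ e1, Y = 2 * e1 := ⟨Y / 2, by omega⟩
  simp only [mul_pow] at h
  have s2 := step e1 X1 Y1 (by omega)
  obtain ⟨e2, rfl⟩ : ∃ e2, e1 = 2 * e2 := ⟨e1 / 2, by omega⟩
  obtain ⟨X2, rfl⟩ : ∃ e2, X1 = 2 * e2 := ⟨X1 / 2, by omega⟩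
  obtain ⟨Y2, rfl⟩ : ∃ e2, Y1 = 2 * e2 := ⟨Y1 / 2, by omega⟩
  simp only [mul_pow] at h
  have h1 := sqmod e2
  refine ⟨by omega, X2, Y2, (X2 ^ 2 - 7 * Y2 ^ 2) / 2, by ring, by ring, by omega⟩

lemma case1_s11 (a b c d e : ℤ) (he : e = 1 - (a ^ 2 + a * b - b ^ 2 - 2 * (c ^ 2 + c * d - d ^ 2)))
    (f : ℚ_[2])
    (hf : f ^ 2 = ((e ^ 2 - 2 * ((2 * c + d) ^ 2 + 5 * (b - d) ^ 2) : ℤ) : ℚ_[2]))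
    (h : 64 ∣ e ^ 2 - 2 * ((2 * c + d) ^ 2 + 5 * (b - d) ^ 2)) :
    ∃ x y : ℚ_[2], ((2 - e - (2 * a + b) : ℤ) : ℚ_[2]) = x ^ 2 + (5 : ℤ) * y ^ 2 := by
  obtain ⟨h8, x, y, k, hX, hY, hk⟩ := descent1 _ _ _ h
  rw [hX, hY] at hf
  obtain ⟨d', rfl⟩ : ∃ d', d = 2 * d' := ⟨d / 2, by omega⟩
  obtain ⟨b', rfl⟩ : ∃ b', b = 2 * b' := ⟨b / 2, by omega⟩
  have hc : c = 2 * x - d' := by omega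
  have hb : b' = d' + 2 * y := by omega
  refine core 1 5 5 e _ (1 - a - b') (b' - 2 * d') (-k) f (by norm_num) (by norm_num) h8 ?_
    (by ring) ?_
  · rw [he, hc, hb]
    linear_combination (-8) * hk
  · have := congrArg (fun w : ℤ => (w : ℚ_[2])) hk
    push_cast at this hf ⊢
    rw [hf]
    linear_combination (-32) * this

lemma case2_s11 (a b c d e : ℤ) (he : e = 1 - (a ^ 2 + a * b - b ^ 2 - 2 * (c ^ 2 + c * d - d ^ 2)))
    (f : ℚ_[2])
    (hf : 7 * f ^ 2 = ((7 * e ^ 2 - 10 * ((2 * c + d - b) ^ 2 - 7 * d ^ 2) : ℤ) : ℚ_[2]))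
    (h : 64 ∣ 7 * e ^ 2 - 10 * ((2 * c + d - b) ^ 2 - 7 * d ^ 2)) :
    ∃ x y : ℚ_[2], ((2 - e - (2 * a + b) : ℤ) : ℚ_[2]) = x ^ 2 + (-7 : ℤ) * y ^ 2 := by
  obtain ⟨h8, x, y, k, hX, hY, hk⟩ := descent2 _ _ _ h
  rw [hX, hY] at hf
  obtain ⟨b', rfl⟩ : ∃ b', b = 2 * b' := ⟨b / 2, by omega⟩
  have hb : b' = c + 2 * y - 2 * x := by omega
  refine core 7 (-1) (-7) e _ (1 - a - b') (2 * c + d + 5 * b') (-5 * k) f (by norm_num)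
    (by norm_num) h8 ?_ (by ring) ?_
  · rw [he, hb, hY]
    linear_combination (-40) * hk
  · have := congrArg (fun w : ℤ => (w : ℚ_[2])) hk
    push_cast at this hf ⊢
    rw [hf]
    linear_combination (-160) * this

lemma norm64 (M : ℤ) (t : ℕ) (ht : t = 3 ∨ t = 4) (u : ℝ) (hu : u ≤ 1)
    (h : ‖(M : ℚ_[2])‖ ≤ (2 : ℝ) ^ (-(2 * (t : ℤ))) * u) : 64 ∣ M := by
  have h1 : ‖(M : ℚ_[2])‖ ≤ ((2 : ℕ) : ℝ) ^ (-(6 : ℕ) : ℤ) := by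
    refine h.trans ?_
    have h2 : (2 : ℝ) ^ (-(2 * (t : ℤ))) * u ≤ (2 : ℝ) ^ (-(2 * (t : ℤ))) :=
      mul_le_of_le_one_right (by positivity) hu
    refine h2.trans ?_
    rcases ht with rfl | rfl <;> norm_num
  rw [Padic.norm_int_le_pow_iff_dvd] at h1
  exact_mod_cast h1

/-- For `t ∈ {3, 4}` and `a₁ ∈ {j + i·j, i + j}`, no element
`r = a + b·ω + c·i + d·(i·ω)` with integer coordinates `0 ≤ a, b, c, d < 2^(t+3)`
satisfies the k-star conditions for `(a₁, t)`. -/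
theorem stmt_11 (t : ℕ) (ht : t = 3 ∨ t = 4) (a₁ : D)
    (ha₁ : a₁ = qj + qi * qj ∨ a₁ = qi + qj) :
    ¬ ∃ a b c d : ℕ, a < 2 ^ (t + 3) ∧ b < 2 ^ (t + 3) ∧ c < 2 ^ (t + 3) ∧
      d < 2 ^ (t + 3) ∧
      kStar a₁ t (algebraMap ℚ_[2] D (a : ℚ_[2]) + algebraMap ℚ_[2] D (b : ℚ_[2]) * qω +
        algebraMap ℚ_[2] D (c : ℚ_[2]) * qi +
        algebraMap ℚ_[2] D (d : ℚ_[2]) * (qi * qω)) := by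
  rintro ⟨a, b, c, d, -, -, -, -, h1, ⟨g, -, h2⟩, h3⟩
  have hr : (algebraMap ℚ_[2] D (a : ℚ_[2]) + algebraMap ℚ_[2] D (b : ℚ_[2]) * qω +
        algebraMap ℚ_[2] D (c : ℚ_[2]) * qi +
        algebraMap ℚ_[2] D (d : ℚ_[2]) * (qi * qω)) =
      ⟨a + b / 2, c + d / 2, b / 2, d / 2⟩ := by
    rw [QuaternionAlgebra.algebraMap_eq, QuaternionAlgebra.algebraMap_eq,
      QuaternionAlgebra.algebraMap_eq, QuaternionAlgebra.algebraMap_eq]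
    ext <;> simp [qω, qi] <;> ring
  rw [hr] at h1 h2 h3
  obtain ⟨e, he⟩ : ∃ e : ℤ, e = 1 - ((a : ℤ) ^ 2 + a * b - b ^ 2 - 2 * (c ^ 2 + c * d - d ^ 2)) :=
    ⟨_, rfl⟩
  have hec := congrArg (fun w : ℤ => (w : ℚ_[2])) he
  push_cast at hec
  have hn : qN (1 - (⟨a + b / 2, c + d / 2, b / 2, d / 2⟩ : D)) =
      ((2 - e - (2 * a + b) : ℤ) : ℚ_[2]) := by
    push_cast
    rw [hec]
    simp [qN]
    ring
  rw [hn] at h1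
  rcases ha₁ with rfl | rfl
  · have hN : qN (qj + qi * qj) = ((5 : ℤ) : ℚ_[2]) := by
      simp [qN, qi, qj]; norm_num
    have hz : qN ((qj + qi * qj) - (⟨a + b / 2, c + d / 2, b / 2, d / 2⟩ : D) * (qj + qi * qj) *
        star (⟨a + b / 2, c + d / 2, b / 2, d / 2⟩ : D)) =
        ((5 * (e ^ 2 - 2 * ((2 * c + d) ^ 2 + 5 * (b - d) ^ 2)) : ℤ) : ℚ_[2]) := by
      push_cast
      rw [hec]
      simp [qN, qi, qj]
      ring
    rw [hN] at h1 h2 h3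
    rw [hz] at h2 h3
    have h64 := norm64 _ t ht _ (Padic.norm_int_le_one 5) h3
    refine h1 (case1_s11 a b c d e he (g / 5) ?_ (by omega))
    push_cast at h2 ⊢
    linear_combination (-1 / 25) * h2
  · have hN : qN (qi + qj) = ((-7 : ℤ) : ℚ_[2]) := by
      simp [qN, qi, qj]; norm_num
    have hz : qN ((qi + qj) - (⟨a + b / 2, c + d / 2, b / 2, d / 2⟩ : D) * (qi + qj) *
        star (⟨a + b / 2, c + d / 2, b / 2, d / 2⟩ : D)) =
        ((-(7 * e ^ 2 - 10 * ((2 * c + d - b) ^ 2 - 7 * d ^ 2)) : ℤ) : ℚ_[2]) := by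
      push_cast
      rw [hec]
      simp [qN, qi, qj]
      ring
    rw [hN] at h1 h2 h3
    rw [hz] at h2 h3
    have h64 := norm64 _ t ht _ (Padic.norm_int_le_one (-7)) h3
    refine h1 (case2_s11 a b c d e he (g / 7) ?_ (by omega))
    push_cast at h2 ⊢
    linear_combination (-1 / 7) * h2
end
end

section
/- Let q ∈ {j + i·j, i + j} ⊆ ℍ[ℚ₂, 2, 5], let r, λ ∈ O_D, let ε ∈ ℚ₂ with ‖ε‖ = 1, and let t ≥ 2 be a natural number. If q = r·q·(star r) + ε·2^t·(λ·q·(star λ)), then 1 − r ∈ i·O_D, i.e., there exists p ∈ D with ‖N(p)‖ ≤ 1 and 1 − r = i·p. -/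
open Quaternion

noncomputable section

def mk4 (x y z w : ℤ_[2]) : D := ⟨x + y / 2, z + w / 2, y / 2, w / 2⟩

lemma s_even (s : ℚ_[2]) (hs : ‖s‖ ≤ 1) : ‖s * (s - 1)‖ < 1 := by
  obtain ⟨s, rfl⟩ : ∃ u : ℤ_[2], (u : ℚ_[2]) = s := ⟨⟨s, hs⟩, rfl⟩
  have : s * (s - 1) ∈ IsLocalRing.maximalIdeal ℤ_[2] := by
    rw [← PadicInt.ker_toZMod, RingHom.mem_ker]
    simp only [map_mul, map_sub, map_one]
    generalize PadicInt.toZMod s = a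
    revert a; decide
  rw [IsLocalRing.mem_maximalIdeal, PadicInt.mem_nonunits] at this
  exact_mod_cast this

lemma unit_norm (e : ℚ_[2]) (he : ‖e‖ < 1) : ‖1 + e‖ = 1 := by
  have := IsUltrametricDist.norm_add_eq_max_of_norm_ne_norm (x := (1 : ℚ_[2])) (y := e)
    (by rw [norm_one]; exact he.ne')
  rw [this, norm_one, max_eq_left he.le]

lemma formA (x y : ℚ_[2]) :
    ∃ e : ℚ_[2], ‖x ^ 2 + x * y - y ^ 2‖ = ‖e‖ ^ 2 ∧ ‖x‖ ≤ ‖e‖ ∧ ‖y‖ ≤ ‖e‖ := by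
  rcases le_total ‖x‖ ‖y‖ with h | h
  · refine ⟨y, ?_, h, le_rfl⟩
    rcases eq_or_ne y 0 with rfl | hy
    · have : x = 0 := by simpa using h
      simp [this]
    have hs : ‖-(x / y)‖ ≤ 1 := by
      rw [norm_neg, norm_div]; exact div_le_one_of_le₀ h (norm_nonneg _)
    have h1 := unit_norm (-(-(x / y) * (-(x / y) - 1))) (by rw [norm_neg]; exact s_even _ hs)
    have : x ^ 2 + x * y - y ^ 2 = -(y ^ 2 * (1 + -(-(x / y) * (-(x / y) - 1)))) := by
      field_simp; ring
    rw [this, norm_neg, norm_mul, h1, norm_pow, mul_one]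
  · refine ⟨x, ?_, le_rfl, h⟩
    rcases eq_or_ne x 0 with rfl | hy
    · have : y = 0 := by simpa using h
      simp [this]
    have hs : ‖y / x‖ ≤ 1 := by
      rw [norm_div]; exact div_le_one_of_le₀ h (norm_nonneg _)
    have h1 := unit_norm (-((y / x) * (y / x - 1))) (by rw [norm_neg]; exact s_even _ hs)
    have : x ^ 2 + x * y - y ^ 2 = x ^ 2 * (1 + -((y / x) * (y / x - 1))) := by
      field_simp; ring
    rw [this, norm_mul, h1, norm_pow, mul_one]

lemma norm_two' : ‖(2 : ℚ_[2])‖ = 1 / 2 := by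
  have := Padic.norm_p (p := 2)
  norm_num at this ⊢
  exact this

lemma small_sq (e : ℚ_[2]) (h : ‖e‖ ^ 2 ≤ 2) : ‖e‖ ≤ 1 := by
  by_contra hc
  push Not at hc
  have he : e ≠ 0 := by rintro rfl; simp at hc; linarith
  rw [Padic.norm_eq_zpow_neg_valuation he] at h hc
  push_cast at h hc
  have h1 : 0 < -e.valuation := by
    by_contra h0
    push Not at h0
    exact absurd (zpow_le_one_of_nonpos₀ (a := (2:ℝ)) (by norm_num) h0) (not_le.2 hc)
  have h2 : (2 : ℝ) ^ (1 : ℤ) ≤ 2 ^ (-e.valuation) := zpow_le_zpow_right₀ (by norm_num) h1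
  rw [zpow_one] at h2
  nlinarith

lemma parity (e f : ℚ_[2]) (h : ‖e‖ ^ 2 = 1 / 2 * ‖f‖ ^ 2) : f = 0 := by
  by_contra hf
  have he : e ≠ 0 := by
    rintro rfl
    simp at h
    exact hf h
  rw [Padic.norm_eq_zpow_neg_valuation he, Padic.norm_eq_zpow_neg_valuation hf] at h
  push_cast at h
  have h' : (2 : ℝ) ^ (-e.valuation * 2) = 2 ^ (-f.valuation * 2 - 1) := by
    rw [zpow_sub₀ (by norm_num), zpow_mul, zpow_mul, zpow_one]
    norm_cast at h ⊢
    rw [h]; ring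
  have := zpow_right_injective₀ (by norm_num : (0:ℝ) < 2) (by norm_num) h'
  omega

lemma integral_coords (r : D) (hr : ‖qN r‖ ≤ 1) : ∃ x y z w : ℤ_[2], r = mk4 x y z w := by
  obtain ⟨a, b, c, d⟩ := r
  obtain ⟨e, he, hx, hy⟩ := formA (a - c) (2 * c)
  obtain ⟨f, hf, hz, hw⟩ := formA (b - d) (2 * d)
  have hN : qN ⟨a, b, c, d⟩ = ((a - c) ^ 2 + (a - c) * (2 * c) - (2 * c) ^ 2) +
      -(2 * ((b - d) ^ 2 + (b - d) * (2 * d) - (2 * d) ^ 2)) := by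
    simp [qN]; ring
  rw [hN] at hr
  have hf' : ‖-(2 * ((b - d) ^ 2 + (b - d) * (2 * d) - (2 * d) ^ 2))‖ = 1 / 2 * ‖f‖ ^ 2 := by
    rw [norm_neg, norm_mul, hf, norm_two']
  have hef : ‖e‖ ≤ 1 ∧ ‖f‖ ≤ 1 := by
    by_cases h : ‖e‖ ^ 2 = 1 / 2 * ‖f‖ ^ 2
    · have := parity e f h
      subst this
      simp at h
      simp [h]
    · rw [IsUltrametricDist.norm_add_eq_max_of_norm_ne_norm (by rw [he, hf']; exact h), he, hf',
        max_le_iff] at hr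
      exact ⟨small_sq e (by linarith), small_sq f (by linarith)⟩
  refine ⟨⟨a - c, hx.trans hef.1⟩, ⟨2 * c, hy.trans hef.1⟩, ⟨b - d, hz.trans hef.2⟩,
    ⟨2 * d, hw.trans hef.2⟩, ?_⟩
  ext <;> simp [mk4]

def Z1 (x y z w : ℤ_[2]) : ℤ_[2] := -(((x+y)^2+y^2)+2*((x+y)*z-y*w)+2*(z^2+w^2))+2*((-2*(x+y)*y+y^2)+2*(-y*z+(x+y)*w-y*w)+2*(2*z*w+w^2))
def W1 (x y z w : ℤ_[2]) : ℤ_[2] := 2*(((x+y)^2+y^2)+2*((x+y)*z-y*w)+2*(z^2+w^2))+((-2*(x+y)*y+y^2)+2*(-y*z+(x+y)*w-y*w)+2*(2*z*w+w^2))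
def Z2 (x y z w : ℤ_[2]) : ℤ_[2] := ((x+y)^2+y^2)+2*(-((x+y)*z-y*w)+2*(-y*z+(x+y)*w-y*w))-2*(z^2+w^2)
def W2 (x y z w : ℤ_[2]) : ℤ_[2] := (-2*(x+y)*y+y^2)+2*(2*((x+y)*z-y*w)+(-y*z+(x+y)*w-y*w))-2*(2*z*w+w^2)

/-- If `q ∈ {j + i·j, i + j}`, `r, λ ∈ O_D`, `ε` is a 2-adic unit, `t ≥ 2` and
`q = r·q·(star r) + ε·2^t·(λ·q·(star λ))`, then `1 - r ∈ i·O_D`. -/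
theorem stmt_12 (q : D) (hq : q = qj + qi * qj ∨ q = qi + qj)
    (r lam : D) (hr : ‖qN r‖ ≤ 1) (hlam : ‖qN lam‖ ≤ 1)
    (ε : ℚ_[2]) (hε : ‖ε‖ = 1) (t : ℕ) (ht : 2 ≤ t)
    (heq : q = r * q * star r +
      algebraMap ℚ_[2] D (ε * 2 ^ t) * (lam * q * star lam)) :
    ∃ p : D, ‖qN p‖ ≤ 1 ∧ 1 - r = qi * p := by
  obtain ⟨x, y, z, w, rfl⟩ := integral_coords r hr
  obtain ⟨x', y', z', w', rfl⟩ := integral_coords lam hlam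
  obtain ⟨s, hs⟩ : ∃ s : ℤ_[2], ε * 2 ^ t = 4 * (s : ℚ_[2]) := by
    obtain ⟨k, rfl⟩ := Nat.exists_eq_add_of_le ht
    obtain ⟨u, rfl⟩ : ∃ u : ℤ_[2], (u : ℚ_[2]) = ε := ⟨⟨ε, hε.le⟩, rfl⟩
    refine ⟨u * 2 ^ k, ?_⟩
    have c2 : ((2 : ℤ_[2]) : ℚ_[2]) = 2 := rfl
    rw [PadicInt.coe_mul, PadicInt.coe_pow, c2]
    ring
  generalize ε * 2 ^ t = e at hs heq
  have c2 : ((2 : ℤ_[2]) : ℚ_[2]) = 2 := rfl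
  have c4 : ((4 : ℤ_[2]) : ℚ_[2]) = 4 := rfl
  have key : (2 : ℤ_[2]) ∣ y ^ 2 ∧ ((2 : ℤ_[2]) ∣ y ^ 2 → (2 : ℤ_[2]) ∣ x ^ 2 - 1) := by
    rcases hq with rfl | rfl
    · have hI := congrArg QuaternionAlgebra.imI heq
      have hK := congrArg QuaternionAlgebra.imK heq
      simp [qi, qj, mk4] at hI hK
      rw [hs] at hI hK
      have hZ : (-1 : ℤ_[2]) = Z1 x y z w + 4 * s * Z1 x' y' z' w' := by
        apply Subtype.coe_injective
        simp only [Z1]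
        push_cast [c2, c4]
        linear_combination hI - hK
      have hW : (2 : ℤ_[2]) = W1 x y z w + 4 * s * W1 x' y' z' w' := by
        apply Subtype.coe_injective
        simp only [W1]
        push_cast [c2, c4]
        linear_combination 2 * hK
      simp only [Z1, W1] at hZ hW
      exact ⟨⟨1-(((x+y)^2+y^2)+2*((x+y)*z-y*w)+2*(z^2+w^2))+(x+y)*y-(-y*z+(x+y)*w-y*w)-(2*z*w+w^2)-2*s*(2*(((x'+y')^2+y'^2)+2*((x'+y')*z'-y'*w')+2*(z'^2+w'^2))+((-2*(x'+y')*y'+y'^2)+2*(-y'*z'+(x'+y')*w'-y'*w')+2*(2*z'*w'+w'^2))), by linear_combination -hW⟩,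
        fun _ => ⟨-x*y-y^2-((x+y)*z-y*w)-(z^2+w^2)+((-2*(x+y)*y+y^2)+2*(-y*z+(x+y)*w-y*w)+2*(2*z*w+w^2))+2*s*(-(((x'+y')^2+y'^2)+2*((x'+y')*z'-y'*w')+2*(z'^2+w'^2))+2*((-2*(x'+y')*y'+y'^2)+2*(-y'*z'+(x'+y')*w'-y'*w')+2*(2*z'*w'+w'^2))), by linear_combination hZ⟩⟩
    · have hI := congrArg QuaternionAlgebra.imI heq
      have hK := congrArg QuaternionAlgebra.imK heq
      simp [qi, qj, mk4] at hI hK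
      rw [hs] at hI hK
      have hZ : (1 : ℤ_[2]) = Z2 x y z w + 4 * s * Z2 x' y' z' w' := by
        apply Subtype.coe_injective
        simp only [Z2]
        push_cast [c2, c4]
        linear_combination hI - hK
      have hW : (0 : ℤ_[2]) = W2 x y z w + 4 * s * W2 x' y' z' w' := by
        apply Subtype.coe_injective
        simp only [W2]
        push_cast [c2, c4]
        linear_combination 2 * hK
      simp only [Z2, W2] at hZ hW
      exact ⟨⟨(x+y)*y-(2*((x+y)*z-y*w)+(-y*z+(x+y)*w-y*w))+(2*z*w+w^2)-2*s*((-2*(x'+y')*y'+y'^2)+2*(2*((x'+y')*z'-y'*w')+(-y'*z'+(x'+y')*w'-y'*w'))-2*(2*z'*w'+w'^2)), by linear_combination -hW⟩,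
        fun _ => ⟨-x*y-y^2-(-((x+y)*z-y*w)+2*(-y*z+(x+y)*w-y*w))+(z^2+w^2)-2*s*(((x'+y')^2+y'^2)+2*(-((x'+y')*z'-y'*w')+2*(-y'*z'+(x'+y')*w'-y'*w'))-2*(z'^2+w'^2)), by linear_combination -hZ⟩⟩
  obtain ⟨hy2, hx2⟩ := key
  have hp : Prime (2 : ℤ_[2]) := by simpa using PadicInt.prime_p (p := 2)
  obtain ⟨m, rfl⟩ := hp.dvd_of_dvd_pow hy2
  obtain ⟨g, hg⟩ := hx2 hy2
  obtain ⟨n, hn⟩ : (2 : ℤ_[2]) ∣ x - 1 :=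
    hp.dvd_of_dvd_pow (n := 2) ⟨g - (x - 1), by linear_combination hg⟩
  obtain rfl : x = 1 + 2 * n := by linear_combination hn
  refine ⟨⟨-(z + w / 2), -(2 * n + m) / 2, -(w / 2), -m / 2⟩, ?_, ?_⟩
  · have : qN ⟨-(z + w / 2), -(2 * n + m) / 2, -(w / 2), -m / 2⟩ =
        ((z ^ 2 + z * w - w ^ 2 - 2 * (n ^ 2 + n * m - m ^ 2) : ℤ_[2]) : ℚ_[2]) := by
      simp [qN, c2]
      ring
    rw [this]
    exact PadicInt.norm_le_one _
  · ext <;> simp [qi, mk4, c2] <;> ring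
end
end
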